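/- arXiv:1704.07693 — 8 statements merged into one kernel-verified Lean document; each statement's English description precedes it below -/
import Mathlib

section
/- Let 𝒳 be a finite set, P a probability mass function on 𝒳, δ > 0, and let X = (X_1, …, X_n) be i.i.d. random variables each with law P. Then the probability that the type T_X fails to satisfy ‖T_X − P‖∞ ≤ δ is at most 2|𝒳|·e^{−2nδ²}; that is, X ∈ T^n_δ(P) with probability at least 1 − 2|𝒳|·e^{−2nδ²}. -/
open scoped Classical
open Finset

/-- The type (empirical distribution) of a sequence `a ∈ 𝒳^n`. -/
noncomputable def empDist {𝒳 : Type*} [Fintype 𝒳] {n : ℕ} (a : Fin n → 𝒳) (α : 𝒳) : ℝ :=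
  ((univ.filter (fun i => a i = α)).card : ℝ) / n

/-- **Hoeffding's lemma** for a probability mass function on a finite type. -/
lemma sum_mul_exp_le_of_sum_mul_eq_zero {𝒳 : Type*} [Fintype 𝒳] {P : 𝒳 → ℝ}
    (hP0 : ∀ x, 0 ≤ P x) (hP1 : ∑ x, P x = 1) {f : 𝒳 → ℝ} {a b : ℝ}
    (hf : ∀ x, f x ∈ Set.Icc a b) (hmean : ∑ x, P x * f x = 0) (t : ℝ) :
    ∑ x, P x * Real.exp (t * f x) ≤ Real.exp ((b - a) ^ 2 * t ^ 2 / 8) := by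
  let _ : MeasurableSpace 𝒳 := ⊤
  have hsum : ∑ x, ENNReal.ofReal (P x) = 1 := by
    rw [← ENNReal.ofReal_sum_of_nonneg fun x _ => hP0 x, hP1, ENNReal.ofReal_one]
  let p : PMF 𝒳 := PMF.ofFintype (fun x => ENNReal.ofReal (P x)) hsum
  have hint (g : 𝒳 → ℝ) : ∫ x, g x ∂p.toMeasure = ∑ x, P x * g x := by
    rw [PMF.integral_eq_sum]
    simp [p, PMF.ofFintype_apply, ENNReal.toReal_ofReal, hP0]
  have hsub := ProbabilityTheory.hasSubgaussianMGF_of_mem_Icc_of_integral_eq_zero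
    (μ := p.toMeasure) (X := f) (a := a) (b := b) (measurable_from_top.aemeasurable)
    (Filter.Eventually.of_forall hf) (by rw [hint, hmean])
  have h := hsub.mgf_le t
  rw [ProbabilityTheory.mgf, hint] at h
  refine h.trans_eq ?_
  congr 1
  push_cast
  rw [div_pow, Real.norm_eq_abs, sq_abs]
  ring

/-- **Hoeffding's inequality** for the product of `n` copies of a probability mass function on a
finite type, for functions with values in an interval of length one. -/
lemma sum_prod_filter_le_exp {𝒳 : Type*} [Fintype 𝒳] {P : 𝒳 → ℝ}
    (hP0 : ∀ x, 0 ≤ P x) (hP1 : ∑ x, P x = 1) {f : 𝒳 → ℝ} {a : ℝ}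
    (hf : ∀ x, f x ∈ Set.Icc a (a + 1)) (hmean : ∑ x, P x * f x = 0)
    {δ : ℝ} (hδ : 0 ≤ δ) (n : ℕ) :
    ∑ x : Fin n → 𝒳 with n * δ ≤ ∑ i, f (x i), ∏ i, P (x i)
      ≤ Real.exp (-2 * n * δ ^ 2) := by
  have hprod (x : Fin n → 𝒳) : 0 ≤ ∏ i, P (x i) := prod_nonneg fun i _ => hP0 (x i)
  calc ∑ x : Fin n → 𝒳 with n * δ ≤ ∑ i, f (x i), ∏ i, P (x i)
      ≤ ∑ x : Fin n → 𝒳 with n * δ ≤ ∑ i, f (x i),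
          Real.exp (-(4 * δ * (n * δ))) * ∏ i, P (x i) * Real.exp (4 * δ * f (x i)) := by
        refine sum_le_sum fun x hx => ?_
        have hx' : n * δ ≤ ∑ i, f (x i) := (mem_filter.1 hx).2
        rw [prod_mul_distrib, ← Real.exp_sum, ← mul_sum, mul_left_comm, ← Real.exp_add]
        refine le_mul_of_one_le_right (hprod x) (Real.one_le_exp ?_)
        have := mul_le_mul_of_nonneg_left hx' (by positivity : 0 ≤ 4 * δ)
        linarith
    _ ≤ ∑ x : Fin n → 𝒳,
          Real.exp (-(4 * δ * (n * δ))) * ∏ i, P (x i) * Real.exp (4 * δ * f (x i)) := by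
        refine sum_le_sum_of_subset_of_nonneg (filter_subset _ _) fun x _ _ => ?_
        exact mul_nonneg (Real.exp_pos _).le
          (prod_nonneg fun i _ => mul_nonneg (hP0 _) (Real.exp_pos _).le)
    _ = Real.exp (-(4 * δ * (n * δ))) * (∑ y, P y * Real.exp (4 * δ * f y)) ^ n := by
        rw [← mul_sum, Fintype.sum_pow]
    _ ≤ Real.exp (-(4 * δ * (n * δ))) * Real.exp (2 * δ ^ 2) ^ n := by
        gcongr
        · exact sum_nonneg fun y _ => mul_nonneg (hP0 y) (Real.exp_pos _).le
        · refine (sum_mul_exp_le_of_sum_mul_eq_zero hP0 hP1 hf hmean (4 * δ)).trans_eq ?_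
          congr 1
          ring
    _ = Real.exp (-2 * n * δ ^ 2) := by
        rw [← Real.exp_nat_mul, ← Real.exp_add]
        congr 1
        ring

lemma sum_biUnion_le_sum_sum {ι κ : Type*} [DecidableEq κ] (s : Finset ι)
    (A : ι → Finset κ) {w : κ → ℝ} (hw : ∀ x, 0 ≤ w x) :
    ∑ x ∈ s.biUnion A, w x ≤ ∑ i ∈ s, ∑ x ∈ A i, w x := by
  induction s using Finset.induction_on with
  | empty => simp
  | insert i s hi ih =>
    rw [biUnion_insert, sum_insert hi]
    have hunion := sum_union_inter (s₁ := A i) (s₂ := s.biUnion A) (f := w)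
    have hinter : 0 ≤ ∑ x ∈ A i ∩ s.biUnion A, w x := sum_nonneg fun x _ => hw x
    linarith

lemma sum_ite_sub_eq_mul_empDist_sub {𝒳 : Type*} [Fintype 𝒳] {n : ℕ} (x : Fin n → 𝒳) (α : 𝒳)
    (c : ℝ) : ∑ i, ((if x i = α then 1 else 0) - c) = n * (empDist x α - c) := by
  rcases Nat.eq_zero_or_pos n with rfl | hn
  · simp
  · have : (n : ℝ) ≠ 0 := by positivity
    simp only [sum_sub_distrib, sum_boole, sum_const, card_univ, Fintype.card_fin, nsmul_eq_mul,
      empDist]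
    field_simp

/-- The empirical frequency of one letter deviates from its probability by more than `δ` with
probability at most `2 e^{-2nδ²}`. -/
lemma sum_prod_filter_abs_empDist_sub_le {𝒳 : Type*} [Fintype 𝒳] {P : 𝒳 → ℝ}
    (hP0 : ∀ x, 0 ≤ P x) (hP1 : ∑ x, P x = 1) {δ : ℝ} (hδ : 0 ≤ δ) (n : ℕ) (α : 𝒳) :
    ∑ x : Fin n → 𝒳 with ¬ |empDist x α - P α| ≤ δ, ∏ i, P (x i)
      ≤ 2 * Real.exp (-2 * n * δ ^ 2) := by
  have hprod (x : Fin n → 𝒳) : 0 ≤ ∏ i, P (x i) := prod_nonneg fun i _ => hP0 (x i)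
  obtain ⟨f, hf⟩ : ∃ f : 𝒳 → ℝ, ∀ y, f y = (if y = α then 1 else 0) - P α := ⟨_, fun _ => rfl⟩
  have hmean : ∑ y, P y * f y = 0 := by
    simp [hf, mul_sub, sum_sub_distrib, ← sum_mul, hP1]
  have hpos := sum_prod_filter_le_exp hP0 hP1 (f := f) (a := -P α)
    (fun y => by rw [hf, Set.mem_Icc]; split_ifs <;> constructor <;> linarith) hmean hδ n
  have hneg := sum_prod_filter_le_exp hP0 hP1 (f := fun y => -f y) (a := P α - 1)
    (fun y => by rw [hf, Set.mem_Icc]; split_ifs <;> constructor <;> linarith)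
    (by simp [hmean]) hδ n
  have hsub : (univ.filter fun x : Fin n → 𝒳 => ¬ |empDist x α - P α| ≤ δ)
      ⊆ (univ.filter fun x : Fin n → 𝒳 => n * δ ≤ ∑ i, f (x i))
        ∪ univ.filter fun x : Fin n → 𝒳 => n * δ ≤ ∑ i, -f (x i) := by
    intro x hx
    have hα := not_le.1 (mem_filter.1 hx).2
    simp only [mem_union, mem_filter, mem_univ, true_and, sum_neg_distrib, hf,
      sum_ite_sub_eq_mul_empDist_sub]
    rw [← mul_neg]
    rcases lt_abs.1 hα with h | h
    · exact Or.inl (mul_le_mul_of_nonneg_left h.le n.cast_nonneg)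
    · exact Or.inr (mul_le_mul_of_nonneg_left h.le n.cast_nonneg)
  refine (sum_le_sum_of_subset_of_nonneg hsub fun x _ _ => hprod x).trans ?_
  rw [two_mul]
  refine le_trans ?_ (add_le_add hpos hneg)
  rw [← sum_union_inter]
  exact le_add_of_nonneg_right (sum_nonneg fun x _ => hprod x)

/-- If `X = (X_1, …, X_n)` is i.i.d. with law `P` (so the law of `X` is the product pmf),
then the probability that the type `T_X` fails `‖T_X − P‖∞ ≤ δ` is at most
`2|𝒳|·e^{−2nδ²}`. -/
theorem stmt0 {𝒳 : Type*} [Fintype 𝒳] (P : 𝒳 → ℝ)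
    (hP0 : ∀ x, 0 ≤ P x) (hP1 : ∑ x, P x = 1)
    (δ : ℝ) (hδ : 0 < δ) (n : ℕ) :
    ∑ x ∈ univ.filter (fun x : Fin n → 𝒳 => ¬ ∀ α, |empDist x α - P α| ≤ δ),
        ∏ i, P (x i)
      ≤ 2 * (Fintype.card 𝒳 : ℝ) * Real.exp (-2 * n * δ ^ 2) := by
  have hprod (x : Fin n → 𝒳) : 0 ≤ ∏ i, P (x i) := prod_nonneg fun i _ => hP0 (x i)
  have hsub : univ.filter (fun x : Fin n → 𝒳 => ¬ ∀ α, |empDist x α - P α| ≤ δ)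
      ⊆ univ.biUnion fun α => univ.filter fun x : Fin n → 𝒳 => ¬ |empDist x α - P α| ≤ δ := by
    intro x hx
    obtain ⟨α, hα⟩ := not_forall.1 (mem_filter.1 hx).2
    exact mem_biUnion.2 ⟨α, mem_univ α, mem_filter.2 ⟨mem_univ x, hα⟩⟩
  refine (sum_le_sum_of_subset_of_nonneg hsub fun x _ _ => hprod x).trans ?_
  refine (sum_biUnion_le_sum_sum _ _ hprod).trans ?_
  refine (sum_le_sum fun α _ =>
    sum_prod_filter_abs_empDist_sub_le hP0 hP1 hδ.le n α).trans_eq ?_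
  rw [sum_const, card_univ, nsmul_eq_mul]
  ring
end

section
/- (Conditional typicality lemma.) Let 𝒮 and 𝒯 be finite sets, P_S a pmf on 𝒮, W(·|·) a conditional pmf from 𝒮 to 𝒯, and 0 < δ₀ ≤ 1. Let s ∈ 𝒮^n satisfy ‖T_s − P_S‖∞ ≤ δ₀, and let T = (T_1, …, T_n) be independent random variables with T_i distributed according to W(·|s_i). Then Pr( (s, T) ∈ T^n_{3δ₀}(P_S W) ) ≥ 1 − 2|𝒮||𝒯|·e^{−2nδ₀³}, where (P_S W)(α,β) = P_S(α)·W(β|α). -/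
open scoped Classical
open Finset

/-- The joint type of a pair of sequences. -/
noncomputable def empDist2 {𝒳 𝒴 : Type*} [Fintype 𝒳] [Fintype 𝒴] {n : ℕ}
    (a : Fin n → 𝒳) (b : Fin n → 𝒴) (α : 𝒳) (β : 𝒴) : ℝ :=
  ((univ.filter (fun i => a i = α ∧ b i = β)).card : ℝ) / n

theorem exp_mul_le_cosh_add_mul_sinh {x : ℝ} (hx : |x| ≤ 1) (l : ℝ) :
    Real.exp (l * x) ≤ Real.cosh l + x * Real.sinh l := by
  obtain ⟨h1, h2⟩ := abs_le.mp hx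
  have h := convexOn_exp.2 (Set.mem_univ l) (Set.mem_univ (-l))
    (show 0 ≤ (1 + x) / 2 by linarith) (show 0 ≤ (1 - x) / 2 by linarith) (by ring)
  simp only [smul_eq_mul] at h
  rw [Real.cosh_eq, Real.sinh_eq]
  calc Real.exp (l * x) = Real.exp ((1 + x) / 2 * l + (1 - x) / 2 * -l) := by congr 1; ring
    _ ≤ _ := h
    _ = _ := by ring

/-- A centred random variable bounded by `1` has moment generating function at most
`exp (l ^ 2 / 2)`. -/
theorem sum_mul_exp_le_exp_half_sq {𝒯 : Type*} [Fintype 𝒯] (w Y : 𝒯 → ℝ)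
    (hw0 : ∀ b, 0 ≤ w b) (hw1 : ∑ b, w b = 1) (hY : ∀ b, |Y b| ≤ 1)
    (hY0 : ∑ b, w b * Y b = 0) (l : ℝ) :
    ∑ b, w b * Real.exp (l * Y b) ≤ Real.exp (l ^ 2 / 2) := by
  calc ∑ b, w b * Real.exp (l * Y b)
      ≤ ∑ b, w b * (Real.cosh l + Y b * Real.sinh l) :=
        sum_le_sum fun b _ =>
          mul_le_mul_of_nonneg_left (exp_mul_le_cosh_add_mul_sinh (hY b) l) (hw0 b)
    _ = (∑ b, w b) * Real.cosh l + (∑ b, w b * Y b) * Real.sinh l := by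
        rw [sum_mul, sum_mul, ← sum_add_distrib]
        exact sum_congr rfl fun b _ => by ring
    _ = Real.cosh l := by rw [hw1, hY0]; ring
    _ ≤ _ := Real.cosh_le_exp_half_sq l

/-- Hoeffding's inequality for independent centred variables bounded by `1` on a finite
product space. -/
theorem sum_prod_filter_le_exp_s2 {𝒯 : Type*} [Fintype 𝒯] {n : ℕ} (w Y : Fin n → 𝒯 → ℝ)
    (hw0 : ∀ i b, 0 ≤ w i b) (hw1 : ∀ i, ∑ b, w i b = 1) (hY : ∀ i b, |Y i b| ≤ 1)
    (hY0 : ∀ i, ∑ b, w i b * Y i b = 0) {r : ℝ} (hr : 0 ≤ r) :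
    ∑ t ∈ univ.filter (fun t : Fin n → 𝒯 => n * r ≤ ∑ i, Y i (t i)), ∏ i, w i (t i)
      ≤ Real.exp (-(n * r ^ 2 / 2)) := by
  have hμ : ∀ t : Fin n → 𝒯, 0 ≤ ∏ i, w i (t i) := fun t => prod_nonneg fun i _ => hw0 i _
  calc ∑ t ∈ univ.filter (fun t : Fin n → 𝒯 => n * r ≤ ∑ i, Y i (t i)), ∏ i, w i (t i)
      ≤ ∑ t ∈ univ.filter (fun t : Fin n → 𝒯 => n * r ≤ ∑ i, Y i (t i)),
          Real.exp (-(n * r ^ 2)) * ∏ i, (w i (t i) * Real.exp (r * Y i (t i))) := by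
        refine sum_le_sum fun t ht => ?_
        have ht' := (mem_filter.mp ht).2
        rw [prod_mul_distrib, ← Real.exp_sum, ← mul_sum, mul_left_comm, ← Real.exp_add]
        refine le_mul_of_one_le_right (hμ t) (Real.one_le_exp ?_)
        nlinarith [mul_le_mul_of_nonneg_left ht' hr]
    _ ≤ ∑ t : Fin n → 𝒯,
          Real.exp (-(n * r ^ 2)) * ∏ i, (w i (t i) * Real.exp (r * Y i (t i))) :=
        sum_le_sum_of_subset_of_nonneg (filter_subset _ _) fun t _ _ =>
          mul_nonneg (Real.exp_pos _).le
            (prod_nonneg fun i _ => mul_nonneg (hw0 i _) (Real.exp_pos _).le)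
    _ = Real.exp (-(n * r ^ 2)) * ∏ i, ∑ b, w i b * Real.exp (r * Y i b) := by
        rw [← mul_sum, Fintype.prod_sum]
    _ ≤ Real.exp (-(n * r ^ 2)) * ∏ _i : Fin n, Real.exp (r ^ 2 / 2) := by
        refine mul_le_mul_of_nonneg_left (prod_le_prod (fun i _ => ?_) fun i _ => ?_)
          (Real.exp_pos _).le
        · exact sum_nonneg fun b _ => mul_nonneg (hw0 i b) (Real.exp_pos _).le
        · exact sum_mul_exp_le_exp_half_sq _ _ (hw0 i) (hw1 i) (hY i) (hY0 i) r
    _ = _ := by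
        rw [← Real.exp_sum, ← Real.exp_add]
        congr 1
        simp
        ring

theorem sum_prod_filter_abs_le_exp {𝒯 : Type*} [Fintype 𝒯] {n : ℕ} (w Y : Fin n → 𝒯 → ℝ)
    (hw0 : ∀ i b, 0 ≤ w i b) (hw1 : ∀ i, ∑ b, w i b = 1) (hY : ∀ i b, |Y i b| ≤ 1)
    (hY0 : ∀ i, ∑ b, w i b * Y i b = 0) {r : ℝ} (hr : 0 ≤ r) :
    ∑ t ∈ univ.filter (fun t : Fin n → 𝒯 => n * r ≤ |∑ i, Y i (t i)|), ∏ i, w i (t i)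
      ≤ 2 * Real.exp (-(n * r ^ 2 / 2)) := by
  have hμ : ∀ t : Fin n → 𝒯, 0 ≤ ∏ i, w i (t i) := fun t => prod_nonneg fun i _ => hw0 i _
  have h1 := sum_prod_filter_le_exp_s2 w Y hw0 hw1 hY hY0 hr
  have h2 := sum_prod_filter_le_exp_s2 w (fun i b => -Y i b) hw0 hw1
    (fun i b => by simpa using hY i b) (fun i => by simpa using hY0 i) hr
  rw [two_mul]
  refine le_trans ?_ (add_le_add h1 h2)
  simp only [sum_filter, ← sum_add_distrib]
  refine sum_le_sum fun t _ => ?_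
  simp only [sum_neg_distrib, le_abs]
  have := hμ t
  split_ifs <;> first | linarith | tauto

/-- The deviation of the joint type from `T_s(σ) W(τ|σ)`, as a sum of centred terms. -/
theorem sum_ite_sub_eq_empDist2 {𝒮 𝒯 : Type*} [Fintype 𝒮] [Fintype 𝒯] {n : ℕ} (hn : n ≠ 0)
    (s : Fin n → 𝒮) (t : Fin n → 𝒯) (σ : 𝒮) (τ : 𝒯) (q : ℝ) :
    ∑ i, (if s i = σ then (if t i = τ then 1 else 0) - q else 0)
      = n * (empDist2 s t σ τ - empDist s σ * q) := by
  have hn' : (n : ℝ) ≠ 0 := Nat.cast_ne_zero.mpr hn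
  have h : ∀ i, (if s i = σ then (if t i = τ then (1 : ℝ) else 0) - q else 0)
      = (if s i = σ ∧ t i = τ then 1 else 0) - (if s i = σ then 1 else 0) * q := by
    intro i
    by_cases h1 : s i = σ <;> simp [h1]
  simp only [h, sum_sub_distrib, ← sum_mul, sum_boole, empDist2, empDist]
  field_simp

/-- Conditional typicality lemma: if `s ∈ T^n_{δ₀}(P_S)` and `T_i ∼ W(·|s_i)` independently
(so the law of `T` is the product `∏ᵢ W(·|s_i)`), then `(s,T) ∈ T^n_{3δ₀}(P_S W)` with
probability at least `1 − 2|𝒮||𝒯|·e^{−2nδ₀³}`. -/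
theorem stmt2 {𝒮 𝒯 : Type*} [Fintype 𝒮] [Fintype 𝒯] {n : ℕ}
    (P : 𝒮 → ℝ) (hP0 : ∀ σ, 0 ≤ P σ) (hP1 : ∑ σ, P σ = 1)
    (W : 𝒮 → 𝒯 → ℝ) (hW0 : ∀ σ τ, 0 ≤ W σ τ) (hW1 : ∀ σ, ∑ τ, W σ τ = 1)
    (δ₀ : ℝ) (hδ₀ : 0 < δ₀) (hδ₀1 : δ₀ ≤ 1)
    (s : Fin n → 𝒮) (hs : ∀ σ, |empDist s σ - P σ| ≤ δ₀) :
    1 - 2 * (Fintype.card 𝒮 : ℝ) * (Fintype.card 𝒯 : ℝ) * Real.exp (-2 * n * δ₀ ^ 3)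
      ≤ ∑ t ∈ univ.filter (fun t : Fin n → 𝒯 =>
            ∀ σ τ, |empDist2 s t σ τ - P σ * W σ τ| ≤ 3 * δ₀),
          ∏ i, W (s i) (t i) := by
  have hμ : ∀ t : Fin n → 𝒯, 0 ≤ ∏ i, W (s i) (t i) := fun t => prod_nonneg fun i _ => hW0 _ _
  have hμ1 : ∑ t : Fin n → 𝒯, ∏ i, W (s i) (t i) = 1 := by
    rw [← Fintype.prod_sum (fun i b => W (s i) b)]
    simp [hW1]
  have hWle : ∀ σ τ, W σ τ ≤ 1 := fun σ τ =>
    (single_le_sum (fun b _ => hW0 σ b) (mem_univ τ)).trans_eq (hW1 σ)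
  rcases Nat.eq_zero_or_pos n with rfl | hn
  · have : Nonempty 𝒮 := by
      by_contra h
      rw [not_nonempty_iff] at h
      simp at hP1
    have : Nonempty 𝒯 := by
      by_contra h
      rw [not_nonempty_iff] at h
      simpa using hW1 (Classical.arbitrary 𝒮)
    have h1 : (1 : ℝ) ≤ Fintype.card 𝒮 := by exact_mod_cast Fintype.card_pos
    have h2 : (1 : ℝ) ≤ Fintype.card 𝒯 := by exact_mod_cast Fintype.card_pos
    refine le_trans ?_ (sum_nonneg fun t _ => hμ t)
    simp only [Nat.cast_zero, mul_zero, zero_mul, Real.exp_zero, mul_one]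
    nlinarith
  have hn' : (0 : ℝ) < n := by exact_mod_cast hn
  set Y : 𝒮 → 𝒯 → Fin n → 𝒯 → ℝ := fun σ τ i b =>
    if s i = σ then (if b = τ then 1 else 0) - W σ τ else 0 with hYdef
  have hdev : ∀ σ τ, ∑ t ∈ univ.filter (fun t : Fin n → 𝒯 => n * (2 * δ₀) ≤ |∑ i, Y σ τ i (t i)|),
      ∏ i, W (s i) (t i) ≤ 2 * Real.exp (-2 * n * δ₀ ^ 3) := by
    intro σ τ
    refine (sum_prod_filter_abs_le_exp (fun i => W (s i)) (Y σ τ) (fun i => hW0 _)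
      (fun i => hW1 _) (fun i b => ?_) (fun i => ?_) (by positivity)).trans ?_
    · have h0 := hW0 σ τ
      have h1 := hWle σ τ
      simp only [hYdef]
      split_ifs <;> rw [abs_le] <;> constructor <;> linarith
    · by_cases h : s i = σ
      · simp [hYdef, h, mul_sub, sum_sub_distrib, ← sum_mul, hW1]
      · simp [hYdef, h]
    · gcongr
      have : (n : ℝ) * δ₀ ^ 3 ≤ n * δ₀ ^ 2 :=
        mul_le_mul_of_nonneg_left (pow_le_pow_of_le_one hδ₀.le hδ₀1 (by norm_num)) hn'.le
      linarith
  have hbad : ∀ t : Fin n → 𝒯, ∀ σ τ, ¬ |empDist2 s t σ τ - P σ * W σ τ| ≤ 3 * δ₀ →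
      n * (2 * δ₀) ≤ |∑ i, Y σ τ i (t i)| := by
    intro t σ τ h
    rw [sum_ite_sub_eq_empDist2 hn.ne', abs_mul, abs_of_pos hn']
    refine mul_le_mul_of_nonneg_left ?_ hn'.le
    have h1 : |(empDist s σ - P σ) * W σ τ| ≤ δ₀ := by
      rw [abs_mul, abs_of_nonneg (hW0 σ τ)]
      exact (mul_le_of_le_one_right (abs_nonneg _) (hWle σ τ)).trans (hs σ)
    have h2 := abs_add_le (empDist2 s t σ τ - empDist s σ * W σ τ) ((empDist s σ - P σ) * W σ τ)
    rw [show empDist2 s t σ τ - empDist s σ * W σ τ + (empDist s σ - P σ) * W σ τ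
      = empDist2 s t σ τ - P σ * W σ τ by ring] at h2
    linarith
  have hsplit := sum_filter_add_sum_filter_not (univ : Finset (Fin n → 𝒯))
    (fun t => ∀ σ τ, |empDist2 s t σ τ - P σ * W σ τ| ≤ 3 * δ₀) (fun t => ∏ i, W (s i) (t i))
  have hunion : ∑ t ∈ univ.filter (fun t : Fin n → 𝒯 =>
        ¬ ∀ σ τ, |empDist2 s t σ τ - P σ * W σ τ| ≤ 3 * δ₀), ∏ i, W (s i) (t i)
      ≤ ∑ x : 𝒮 × 𝒯, ∑ t ∈ univ.filter (fun t : Fin n → 𝒯 =>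
          n * (2 * δ₀) ≤ |∑ i, Y x.1 x.2 i (t i)|), ∏ i, W (s i) (t i) := by
    simp only [sum_filter]
    rw [sum_comm]
    refine sum_le_sum fun t _ => ?_
    have hnn : ∀ x ∈ (univ : Finset (𝒮 × 𝒯)),
        0 ≤ if n * (2 * δ₀) ≤ |∑ i, Y x.1 x.2 i (t i)| then ∏ i, W (s i) (t i) else 0 :=
      fun x _ => by split_ifs; exacts [hμ t, le_rfl]
    split_ifs with h
    · exact sum_nonneg hnn
    · push Not at h
      obtain ⟨σ, τ, h⟩ := h
      refine le_trans ?_ (single_le_sum hnn (mem_univ (σ, τ)))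
      rw [if_pos (hbad t σ τ h.not_ge)]
  have hsum := hunion.trans (sum_le_sum fun x _ => hdev x.1 x.2)
  simp only [sum_const, card_univ, Fintype.card_prod, nsmul_eq_mul, Nat.cast_mul] at hsum
  rw [hμ1] at hsplit
  linarith
end

section
/- Let 𝒴 and 𝒰 be finite sets, P and Q pmfs on 𝒴 with ‖P − Q‖₁ = θ where 0 < θ ≤ 1/2, and K a conditional pmf from 𝒴 to 𝒰. Then the conditional entropies of U given Y under the joint pmfs P ⊗ K and Q ⊗ K satisfy |H_{P⊗K}(U|Y) − H_{Q⊗K}(U|Y)| ≤ 2θ·log₂(|𝒰||𝒴|/θ). -/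
open Finset

/-- Shannon entropy (base 2) of a pmf on a finite set, with the convention `0·log 0 = 0`
(automatic, since `Real.logb 2 0 = 0`). -/
noncomputable def ent {𝒜 : Type*} [Fintype 𝒜] (P : 𝒜 → ℝ) : ℝ :=
  -∑ a, P a * Real.logb 2 (P a)

/-- Conditional entropy `H_R(U|Y) = H(R) − H(R_Y)` of a joint pmf `R` on `𝒰 × 𝒴`. -/
noncomputable def condEnt {𝒰 𝒴 : Type*} [Fintype 𝒰] [Fintype 𝒴] (R : 𝒰 → 𝒴 → ℝ) : ℝ :=
  ent (fun p : 𝒰 × 𝒴 => R p.1 p.2) - ent (fun y => ∑ u, R u y)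

/-- The entropy of a pmf is nonnegative. -/
lemma ent_nonneg {𝒜 : Type*} [Fintype 𝒜] {p : 𝒜 → ℝ} (h0 : ∀ a, 0 ≤ p a)
    (h1 : ∑ a, p a = 1) : 0 ≤ ent p := by
  unfold ent
  rw [neg_nonneg]
  refine Finset.sum_nonpos fun a _ => mul_nonpos_of_nonneg_of_nonpos (h0 a) ?_
  exact Real.logb_nonpos one_lt_two (h0 a)
    (h1 ▸ Finset.single_le_sum (fun b _ => h0 b) (Finset.mem_univ a))

/-- The entropy of a pmf is at most the logarithm of the size of its alphabet. -/
lemma ent_le_logb_card {𝒜 : Type*} [Fintype 𝒜] [Nonempty 𝒜] {p : 𝒜 → ℝ}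
    (h0 : ∀ a, 0 ≤ p a) (h1 : ∑ a, p a = 1) :
    ent p ≤ Real.logb 2 (Fintype.card 𝒜) := by
  have hn : (0 : ℝ) < Fintype.card 𝒜 := by exact_mod_cast Fintype.card_pos
  have key : ∀ a, -(p a * Real.log (p a)) ≤
      p a * Real.log (Fintype.card 𝒜) + (1 / (Fintype.card 𝒜 : ℝ) - p a) := by
    intro a
    rcases (h0 a).eq_or_lt with h | h
    · rw [← h]
      simp
    · have hl := Real.log_le_sub_one_of_pos (x := 1 / (Fintype.card 𝒜 * p a)) (by positivity)
      rw [one_div, Real.log_inv, Real.log_mul hn.ne' h.ne'] at hl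
      have hm := mul_le_mul_of_nonneg_left hl h.le
      have he : p a * ((Fintype.card 𝒜 * p a)⁻¹ - 1) = 1 / (Fintype.card 𝒜 : ℝ) - p a := by
        field_simp
      rw [he] at hm
      linarith
  have hs := Finset.sum_le_sum fun a (_ : a ∈ Finset.univ) => key a
  rw [Finset.sum_add_distrib, ← Finset.sum_mul, Finset.sum_sub_distrib, h1] at hs
  have hc : ∑ _a : 𝒜, 1 / (Fintype.card 𝒜 : ℝ) = 1 := by
    simp [hn.ne']
  rw [hc, Finset.sum_neg_distrib] at hs
  unfold ent
  simp only [Real.logb, mul_div_assoc']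
  rw [← Finset.sum_div, ← neg_div]
  exact div_le_div_of_nonneg_right (by linarith) (Real.log_nonneg one_le_two)

/-- The conditional entropy of `P ⊗ K` is the `P`-average of the entropies of the rows of `K`. -/
lemma condEnt_mul {𝒰 𝒴 : Type*} [Fintype 𝒰] [Fintype 𝒴] (P : 𝒴 → ℝ) {K : 𝒴 → 𝒰 → ℝ}
    (hK1 : ∀ y, ∑ u, K y u = 1) :
    condEnt (fun u y => P y * K y u) = ∑ y, P y * ent (K y) := by
  have key : ∀ y u, P y * K y u * Real.logb 2 (P y * K y u) =
      P y * Real.logb 2 (P y) * K y u + P y * (K y u * Real.logb 2 (K y u)) := by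
    intro y u
    by_cases hP : P y = 0
    · simp [hP]
    by_cases hK : K y u = 0
    · simp [hK]
    rw [Real.logb_mul hP hK]
    ring
  unfold condEnt ent
  simp only [Fintype.sum_prod_type_right, key, ← Finset.mul_sum, Finset.sum_add_distrib, hK1,
    mul_one, mul_neg, Finset.sum_neg_distrib]
  ring

/-- If `‖P − Q‖₁ = θ` with `0 < θ ≤ 1/2` and `K` is a conditional pmf from `𝒴` to `𝒰`,
then `|H_{P⊗K}(U|Y) − H_{Q⊗K}(U|Y)| ≤ 2θ·log₂(|𝒰||𝒴|/θ)`. -/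
theorem stmt7 {𝒴 𝒰 : Type*} [Fintype 𝒴] [Fintype 𝒰]
    (P Q : 𝒴 → ℝ)
    (hP0 : ∀ y, 0 ≤ P y) (hP1 : ∑ y, P y = 1)
    (hQ0 : ∀ y, 0 ≤ Q y) (hQ1 : ∑ y, Q y = 1)
    (K : 𝒴 → 𝒰 → ℝ) (hK0 : ∀ y u, 0 ≤ K y u) (hK1 : ∀ y, ∑ u, K y u = 1)
    (θ : ℝ) (hθ : θ = ∑ y, |P y - Q y|) (hθ0 : 0 < θ) (hθhalf : θ ≤ 1 / 2) :
    |condEnt (fun u y => P y * K y u) - condEnt (fun u y => Q y * K y u)|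
      ≤ 2 * θ * Real.logb 2 ((Fintype.card 𝒰 : ℝ) * (Fintype.card 𝒴 : ℝ) / θ) := by
  rw [condEnt_mul P hK1, condEnt_mul Q hK1, ← Finset.sum_sub_distrib]
  have : Nonempty 𝒴 := by
    by_contra h
    rw [not_nonempty_iff] at h
    simp at hP1
  have : Nonempty 𝒰 := by
    by_contra h
    rw [not_nonempty_iff] at h
    simpa using hK1 (Classical.arbitrary 𝒴)
  have hU : (1 : ℝ) ≤ Fintype.card 𝒰 := by exact_mod_cast Fintype.card_pos (α := 𝒰)
  have hY : (1 : ℝ) ≤ Fintype.card 𝒴 := by exact_mod_cast Fintype.card_pos (α := 𝒴)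
  have hlog : Real.logb 2 (Fintype.card 𝒰) ≤
      Real.logb 2 ((Fintype.card 𝒰 : ℝ) * (Fintype.card 𝒴 : ℝ) / θ) := by
    refine Real.logb_le_logb_of_le one_lt_two (by linarith) ?_
    rw [le_div_iff₀ hθ0]
    exact mul_le_mul_of_nonneg_left (by linarith) (by linarith)
  have hlog0 : 0 ≤ Real.logb 2 (Fintype.card 𝒰 : ℝ) := Real.logb_nonneg one_lt_two hU
  calc |∑ y, (P y * ent (K y) - Q y * ent (K y))|
      ≤ ∑ y, |P y * ent (K y) - Q y * ent (K y)| := Finset.abs_sum_le_sum_abs _ _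
    _ ≤ ∑ y, |P y - Q y| * Real.logb 2 (Fintype.card 𝒰) := by
        refine Finset.sum_le_sum fun y _ => ?_
        rw [← sub_mul, abs_mul, abs_of_nonneg (ent_nonneg (hK0 y) (hK1 y))]
        exact mul_le_mul_of_nonneg_left (ent_le_logb_card (hK0 y) (hK1 y)) (abs_nonneg _)
    _ = θ * Real.logb 2 (Fintype.card 𝒰) := by rw [← Finset.sum_mul, ← hθ]
    _ ≤ 2 * θ * Real.logb 2 ((Fintype.card 𝒰 : ℝ) * (Fintype.card 𝒴 : ℝ) / θ) :=
        mul_le_mul (by linarith) hlog hlog0 (by linarith)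
end

section
/- Let 𝒰, 𝒴, 𝒵 be finite sets and fix a pmf P_{Y,Z} on 𝒴 × 𝒵. For each conditional pmf K from 𝒴 to 𝒰 define the joint pmf P_K on 𝒰 × 𝒴 × 𝒵 by P_K(u,y,z) = P_{Y,Z}(y,z)·K(u|y). Then the map K ↦ I_{P_K}(U;Y|Z) is a convex function on the convex set of all conditional pmfs from 𝒴 to 𝒰. -/
open Finset

/-- Conditional mutual information `I(U;Y|Z)` (base 2) of a joint pmf `P` on `𝒰 × 𝒴 × 𝒵`,
with the convention `0·log(·) = 0`. -/
noncomputable def cmi {𝒰 𝒴 𝒵 : Type*} [Fintype 𝒰] [Fintype 𝒴] [Fintype 𝒵]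
    (P : 𝒰 → 𝒴 → 𝒵 → ℝ) : ℝ :=
  ∑ u, ∑ y, ∑ z,
    P u y z * Real.logb 2
      ((∑ u', ∑ y', P u' y' z) * P u y z / ((∑ y', P u y' z) * (∑ u', P u' y z)))

theorem mul_log_add_sub_le_mul_log_div {a b c : ℝ} (ha : 0 ≤ a) (hb : 0 ≤ b) (hab : b = 0 → a = 0)
    (hc : 0 < c) : a * Real.log c + a - b * c ≤ a * Real.log (a / b) := by
  rcases ha.eq_or_lt with rfl | ha
  · simpa using mul_nonneg hb hc.le
  have hb : 0 < b := hb.lt_of_ne fun h => ha.ne' (hab h.symm)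
  have h := mul_le_mul_of_nonneg_left
    (Real.one_sub_inv_le_log_of_pos (x := a / b / c) (by positivity)) ha.le
  rw [Real.log_div (by positivity) hc.ne'] at h
  have e : a * (1 - (a / b / c)⁻¹) = a - b * c := by field_simp
  linarith

/-- The two-term log-sum inequality: `(a, b) ↦ a * log (a / b)` is jointly convex. -/
theorem convexOn_mul_log_div :
    ConvexOn ℝ {x : ℝ × ℝ | 0 ≤ x.1 ∧ 0 ≤ x.2 ∧ (x.2 = 0 → x.1 = 0)}
      (fun x => x.1 * Real.log (x.1 / x.2)) := by
  have hconv : Convex ℝ {x : ℝ × ℝ | 0 ≤ x.1 ∧ 0 ≤ x.2 ∧ (x.2 = 0 → x.1 = 0)} := by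
    rintro ⟨a, b⟩ ⟨ha, hb, hab⟩ ⟨c, d⟩ ⟨hc, hd, hcd⟩ s t hs ht -
    simp only [Set.mem_ofPred_eq, Prod.smul_mk, Prod.mk_add_mk, smul_eq_mul] at *
    refine ⟨by positivity, by positivity, fun h => ?_⟩
    rw [add_eq_zero_iff_of_nonneg (by positivity) (by positivity), mul_eq_zero, mul_eq_zero] at h
    have h1 : s * a = 0 := mul_eq_zero.2 (h.1.imp_right hab)
    have h2 : t * c = 0 := mul_eq_zero.2 (h.2.imp_right hcd)
    rw [h1, h2, add_zero]
  refine ⟨hconv, ?_⟩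
  intro x hx y hy s t hs ht hst
  have hz := hconv hx hy hs ht hst
  obtain ⟨a, b⟩ := x
  obtain ⟨c, d⟩ := y
  simp only [Set.mem_ofPred_eq, Prod.smul_mk, Prod.mk_add_mk, smul_eq_mul] at *
  obtain ⟨hA, hB, hAB⟩ := hz
  obtain ⟨ha, hb, hab⟩ := hx
  obtain ⟨hc, hd, hcd⟩ := hy
  rcases hA.eq_or_lt with hA | hA
  · have h := hA.symm
    rw [add_eq_zero_iff_of_nonneg (by positivity) (by positivity)] at h
    rw [← mul_assoc, ← mul_assoc, h.1, h.2]
    simp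
  have hB : 0 < s * b + t * d := hB.lt_of_ne fun h => hA.ne' (hAB h.symm)
  have hq := div_pos hA hB
  have h1 := mul_le_mul_of_nonneg_left (mul_log_add_sub_le_mul_log_div ha hb hab hq) hs
  have h2 := mul_le_mul_of_nonneg_left (mul_log_add_sub_le_mul_log_div hc hd hcd hq) ht
  have e : (s * b + t * d) * ((s * a + t * c) / (s * b + t * d)) = s * a + t * c := by
    field_simp
  linear_combination h1 + h2 + e

/-- For a fixed pmf `P_{Y,Z}`, the map `K ↦ I_{P_K}(U;Y|Z)`, where
`P_K(u,y,z) = P_{Y,Z}(y,z)·K(u|y)`, is convex on the convex set of conditional pmfs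
from `𝒴` to `𝒰`. -/
theorem stmt9 {𝒰 𝒴 𝒵 : Type*} [Fintype 𝒰] [Fintype 𝒴] [Fintype 𝒵]
    (Pyz : 𝒴 → 𝒵 → ℝ)
    (hP0 : ∀ y z, 0 ≤ Pyz y z) (hP1 : ∑ y, ∑ z, Pyz y z = 1) :
    ConvexOn ℝ
      {K : 𝒴 → 𝒰 → ℝ | (∀ y u, 0 ≤ K y u) ∧ ∀ y, ∑ u, K y u = 1}
      (fun K => cmi (fun u y z => Pyz y z * K y u)) := by
  have hS : Convex ℝ {K : 𝒴 → 𝒰 → ℝ | (∀ y u, 0 ≤ K y u) ∧ ∀ y, ∑ u, K y u = 1} := by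
    rintro K ⟨hK, hK1⟩ L ⟨hL, hL1⟩ s t hs ht hst
    refine ⟨fun y u => add_nonneg (mul_nonneg hs (hK y u)) (mul_nonneg ht (hL y u)), fun y => ?_⟩
    simp [sum_add_distrib, ← mul_sum, hK1, hL1, hst]
  set r : 𝒵 → ℝ := fun z => ∑ y, Pyz y z
  have hform : ∀ K ∈ {K : 𝒴 → 𝒰 → ℝ | (∀ y u, 0 ≤ K y u) ∧ ∀ y, ∑ u, K y u = 1},
      cmi (fun u y z => Pyz y z * K y u) = ∑ u, ∑ y, ∑ z,
        (Real.log 2)⁻¹ * ((Pyz y z * K y u) * Real.log ((Pyz y z * K y u) /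
          ((∑ y', Pyz y' z * K y' u) * Pyz y z / r z))) := by
    rintro K ⟨-, hK1⟩
    have h1 : ∀ z, ∑ u, ∑ y, Pyz y z * K y u = r z := fun z => by
      rw [sum_comm]
      simp [← mul_sum, hK1, r]
    simp only [cmi, h1, ← mul_sum, hK1, mul_one, Real.logb]
    simp only [mul_sum]
    refine sum_congr rfl fun u _ => sum_congr rfl fun y _ => sum_congr rfl fun z _ => ?_
    rw [div_div_eq_mul_div, mul_comm (r z)]
    ring
  refine ⟨hS, fun K hK L hL s t hs ht hst => ?_⟩
  simp only [hform K hK, hform L hL, hform _ (hS hK hL hs ht hst), smul_eq_mul, mul_sum,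
    ← sum_add_distrib]
  refine sum_le_sum fun u _ => sum_le_sum fun y _ => sum_le_sum fun z _ => ?_
  have hmem : ∀ M ∈ {K : 𝒴 → 𝒰 → ℝ | (∀ y u, 0 ≤ K y u) ∧ ∀ y, ∑ u, K y u = 1},
      (Pyz y z * M y u, (∑ y', Pyz y' z * M y' u) * Pyz y z / r z) ∈
        {x : ℝ × ℝ | 0 ≤ x.1 ∧ 0 ≤ x.2 ∧ (x.2 = 0 → x.1 = 0)} := by
    rintro M ⟨hM, -⟩
    have hp : ∀ y' ∈ univ, 0 ≤ Pyz y' z * M y' u := fun y' _ => mul_nonneg (hP0 y' z) (hM y' u)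
    have hw : ∀ y' ∈ univ, 0 ≤ Pyz y' z := fun y' _ => hP0 y' z
    refine ⟨hp y (mem_univ y), div_nonneg (mul_nonneg (sum_nonneg hp) (hP0 y z))
      (sum_nonneg hw), fun h => ?_⟩
    rcases div_eq_zero_iff.1 h with h | h
    · rcases mul_eq_zero.1 h with h | h
      · exact (sum_eq_zero_iff_of_nonneg hp).1 h y (mem_univ y)
      · simp [h]
    · simp [(sum_eq_zero_iff_of_nonneg hw).1 h y (mem_univ y)]
  have key := convexOn_mul_log_div.2 (hmem K hK) (hmem L hL) hs ht hst
  have e1 : Pyz y z * (s • K + t • L) y u = s * (Pyz y z * K y u) + t * (Pyz y z * L y u) := by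
    simp only [Pi.add_apply, Pi.smul_apply, smul_eq_mul]
    ring
  have e2 : (∑ y', Pyz y' z * (s • K + t • L) y' u) * Pyz y z / r z =
      s * ((∑ y', Pyz y' z * K y' u) * Pyz y z / r z) +
        t * ((∑ y', Pyz y' z * L y' u) * Pyz y z / r z) := by
    have : ∑ y', Pyz y' z * (s • K + t • L) y' u =
        s * (∑ y', Pyz y' z * K y' u) + t * (∑ y', Pyz y' z * L y' u) := by
      rw [mul_sum, mul_sum, ← sum_add_distrib]
      refine sum_congr rfl fun y' _ => ?_
      simp only [Pi.add_apply, Pi.smul_apply, smul_eq_mul]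
      ring
    rw [this]
    ring
  rw [e1, e2]
  simp only [Prod.smul_mk, Prod.mk_add_mk, smul_eq_mul] at key
  have h2 := mul_le_mul_of_nonneg_left key (inv_nonneg.2 (Real.log_nonneg one_le_two))
  linear_combination h2
end

section
/- Let 𝒳, 𝒥, 𝒴, 𝒵, 𝒳̃ be finite sets, P_X a pmf on 𝒳, Q a conditional pmf from 𝒳 to 𝒥, W a conditional pmf from 𝒳 × 𝒥 to 𝒴 × 𝒵, and d : 𝒳 × 𝒳̃ → ℝ≥0 a distortion measure. Let 𝒰 be the (finite) set of all functions from 𝒵 to 𝒳̃. For each conditional pmf K from 𝒴 to 𝒰 define the joint pmf P_K(x,j,y,z,u) = P_X(x)·Q(j|x)·W(y,z|x,j)·K(u|y) and the average distortion Δ(K) = Σ_{x,j,y,z,u} P_K(x,j,y,z,u)·d(x, u(z)). Define F : ℝ → [0, +∞] by F(D) = inf{ I_{P_K}(U;Y|Z) : K a conditional pmf from 𝒴 to 𝒰 with Δ(K) ≤ D }, with inf ∅ = +∞. Then F is non-increasing in D, convex in D, and continuous on the interior of the set { D : F(D) < +∞ }. -/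
open Finset
open scoped ENNReal

lemma mul_log_div_tangent {a q A B b c : ℝ} (ha : 0 ≤ a) (hq : 0 ≤ q) (haq : q = 0 → a = 0)
    (hA : 0 < A) (hB : 0 < B) (hb : 0 < b) (hc : 0 < c) :
    a * Real.log (c * A / (B * b)) + (a - q * A / B) ≤ a * Real.log (c * a / (q * b)) := by
  rcases ha.eq_or_lt with rfl | ha
  · simp only [zero_mul, zero_sub, zero_add, Left.neg_nonpos_iff]
    positivity
  have hq' : 0 < q := hq.lt_of_ne fun h => ha.ne' (haq h.symm)
  have h := Real.log_le_sub_one_of_pos (x := q * A / (B * a)) (by positivity)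
  have e : Real.log (q * A / (B * a)) =
      Real.log (c * A / (B * b)) - Real.log (c * a / (q * b)) := by
    rw [← Real.log_div (by positivity) (by positivity)]
    congr 1
    field_simp
  rw [e] at h
  have h' := mul_le_mul_of_nonneg_left h ha.le
  have e' : a * (q * A / (B * a) - 1) = q * A / B - a := by field_simp
  rw [e'] at h'
  linarith

lemma mul_log_div_convex {a₁ a₂ q₁ q₂ b c t s : ℝ} (ha₁ : 0 ≤ a₁) (ha₂ : 0 ≤ a₂)
    (hq₁ : 0 ≤ q₁) (hq₂ : 0 ≤ q₂) (h₁ : q₁ = 0 → a₁ = 0) (h₂ : q₂ = 0 → a₂ = 0)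
    (hb : 0 ≤ b) (hc : 0 ≤ c) (ht : 0 < t) (hs : 0 < s) :
    (t * a₁ + s * a₂) * Real.log (c * (t * a₁ + s * a₂) / ((t * q₁ + s * q₂) * b)) ≤
      t * (a₁ * Real.log (c * a₁ / (q₁ * b))) + s * (a₂ * Real.log (c * a₂ / (q₂ * b))) := by
  rcases hb.eq_or_lt with rfl | hb
  · simp
  rcases hc.eq_or_lt with rfl | hc
  · simp
  have hA : 0 ≤ t * a₁ + s * a₂ := by positivity
  have hB : 0 ≤ t * q₁ + s * q₂ := by positivity
  rcases hA.eq_or_lt with hA0 | hA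
  · have e₁ : a₁ = 0 := by
      by_contra h
      have : 0 < a₁ := ha₁.lt_of_ne (Ne.symm h)
      have : 0 < t * a₁ + s * a₂ := by positivity
      linarith
    have e₂ : a₂ = 0 := by
      by_contra h
      have : 0 < a₂ := ha₂.lt_of_ne (Ne.symm h)
      have : 0 < t * a₁ + s * a₂ := by positivity
      linarith
    simp [e₁, e₂]
  rcases hB.eq_or_lt with hB0 | hB
  · have e₁ : q₁ = 0 := by
      by_contra h
      have : 0 < q₁ := hq₁.lt_of_ne (Ne.symm h)
      have : 0 < t * q₁ + s * q₂ := by positivity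
      linarith
    have e₂ : q₂ = 0 := by
      by_contra h
      have : 0 < q₂ := hq₂.lt_of_ne (Ne.symm h)
      have : 0 < t * q₁ + s * q₂ := by positivity
      linarith
    simp [h₁ e₁, h₂ e₂]
  have k₁ := mul_le_mul_of_nonneg_left (mul_log_div_tangent ha₁ hq₁ h₁ hA hB hb hc) ht.le
  have k₂ := mul_le_mul_of_nonneg_left (mul_log_div_tangent ha₂ hq₂ h₂ hA hB hb hc) hs.le
  have e : t * (q₁ * (t * a₁ + s * a₂) / (t * q₁ + s * q₂)) +
      s * (q₂ * (t * a₁ + s * a₂) / (t * q₁ + s * q₂)) = t * a₁ + s * a₂ := by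
    field_simp
  linarith

/-- On nonnegative arrays with a prescribed `(y,z)`-marginal, `cmi` is convex. -/
lemma cmi_convex {𝒰 𝒴 𝒵 : Type*} [Fintype 𝒰] [Fintype 𝒴] [Fintype 𝒵]
    {P₁ P₂ : 𝒰 → 𝒴 → 𝒵 → ℝ} (h₁ : ∀ u y z, 0 ≤ P₁ u y z) (h₂ : ∀ u y z, 0 ≤ P₂ u y z)
    (h : ∀ y z, ∑ u, P₁ u y z = ∑ u, P₂ u y z) {t s : ℝ} (ht : 0 < t) (hs : 0 < s)
    (hts : t + s = 1) :
    cmi (fun u y z => t * P₁ u y z + s * P₂ u y z) ≤ t * cmi P₁ + s * cmi P₂ := by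
  unfold cmi
  rw [mul_sum, mul_sum, ← sum_add_distrib]
  refine sum_le_sum fun u _ => ?_
  rw [mul_sum, mul_sum, ← sum_add_distrib]
  refine sum_le_sum fun y _ => ?_
  rw [mul_sum, mul_sum, ← sum_add_distrib]
  refine sum_le_sum fun z _ => ?_
  have hm : ∀ y z, ∑ u, (t * P₁ u y z + s * P₂ u y z) = ∑ u, P₁ u y z := fun y z => by
    rw [sum_add_distrib, ← mul_sum, ← mul_sum, ← h, ← add_mul, hts, one_mul]
  have hc : ∑ u, ∑ y, (t * P₁ u y z + s * P₂ u y z) = ∑ u, ∑ y, P₁ u y z := by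
    rw [sum_comm, sum_comm (f := fun u y => P₁ u y z)]
    exact sum_congr rfl fun y _ => hm y z
  have hc' : ∑ u, ∑ y, P₂ u y z = ∑ u, ∑ y, P₁ u y z := by
    rw [sum_comm, sum_comm (f := fun u y => P₁ u y z)]
    exact sum_congr rfl fun y _ => (h y z).symm
  have hz : ∀ {P : 𝒰 → 𝒴 → 𝒵 → ℝ}, (∀ u y z, 0 ≤ P u y z) → ∑ y, P u y z = 0 → P u y z = 0 :=
    fun hP h0 => (sum_eq_zero_iff_of_nonneg fun y _ => hP u y z).1 h0 y (mem_univ y)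
  have key := mul_log_div_convex (b := ∑ u, P₁ u y z) (c := ∑ u, ∑ y, P₁ u y z) (h₁ u y z) (h₂ u y z)
    (sum_nonneg fun y _ => h₁ u y z) (sum_nonneg fun y _ => h₂ u y z) (hz h₁) (hz h₂)
    (sum_nonneg fun u _ => h₁ u y z)
    (sum_nonneg fun u _ => sum_nonneg fun y _ => h₁ u y z) ht hs
  have key' := div_le_div_of_nonneg_right key (Real.log_pos one_lt_two).le
  rw [hc, hm, hc', ← h, sum_add_distrib, ← mul_sum, ← mul_sum]
  simp only [Real.logb]
  convert key' using 1 <;> ring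

lemma le_mul_sInf_add_mul_sInf {S₁ S₂ : Set ℝ≥0∞} {a b L : ℝ≥0∞} (ha : a ≠ 0) (ha' : a ≠ ⊤)
    (hb : b ≠ 0) (hb' : b ≠ ⊤) (h : ∀ v ∈ S₁, ∀ w ∈ S₂, L ≤ a * v + b * w) :
    L ≤ a * sInf S₁ + b * sInf S₂ := by
  simp only [sInf_eq_iInf', ENNReal.mul_iInf_of_ne ha ha', ENNReal.mul_iInf_of_ne hb hb',
    ENNReal.iInf_add, ENNReal.add_iInf]
  exact le_iInf fun w => le_iInf fun v => h v v.2 w w.2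

/-- A convex `ℝ≥0∞`-valued function on `ℝ` is continuous on the interior of its domain. -/
lemma continuousOn_interior_of_convex {F : ℝ → ℝ≥0∞}
    (hF : ∀ (x y t : ℝ), 0 ≤ t → t ≤ 1 →
      F (t * x + (1 - t) * y) ≤ ENNReal.ofReal t * F x + ENNReal.ofReal (1 - t) * F y) :
    ContinuousOn F (interior {x | F x < ⊤}) := by
  have hfin : ∀ x y t : ℝ, F x < ⊤ → F y < ⊤ →
      ENNReal.ofReal t * F x + ENNReal.ofReal (1 - t) * F y < ⊤ := fun x y t hx hy =>
    ENNReal.add_lt_top.2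
      ⟨ENNReal.mul_lt_top ENNReal.ofReal_lt_top hx, ENNReal.mul_lt_top ENNReal.ofReal_lt_top hy⟩
  have hconv : Convex ℝ {x | F x < ⊤} := by
    intro x hx y hy t s ht hs hts
    obtain rfl : s = 1 - t := by linarith
    exact (hF x y t ht (by linarith)).trans_lt (hfin x y t hx hy)
  have hg : ConvexOn ℝ (interior {x | F x < ⊤}) fun x => (F x).toReal := by
    refine ⟨hconv.interior, fun x hx y hy t s ht hs hts => ?_⟩
    obtain rfl : s = 1 - t := by linarith
    have hx' : x ∈ {x | F x < ⊤} := interior_subset hx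
    have hy' : y ∈ {x | F x < ⊤} := interior_subset hy
    have h := ENNReal.toReal_mono (hfin x y t hx' hy').ne (hF x y t ht (by linarith))
    rw [ENNReal.toReal_add (ENNReal.mul_lt_top ENNReal.ofReal_lt_top hx').ne
      (ENNReal.mul_lt_top ENNReal.ofReal_lt_top hy').ne, ENNReal.toReal_mul, ENNReal.toReal_mul,
      ENNReal.toReal_ofReal ht, ENNReal.toReal_ofReal hs] at h
    exact h
  refine (ENNReal.continuous_ofReal.comp_continuousOn
    (hg.continuousOn isOpen_interior)).congr fun x hx => ?_
  have hx' : x ∈ {x | F x < ⊤} := interior_subset hx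
  exact (ENNReal.ofReal_toReal hx'.ne).symm

/-- Let `𝒰 = 𝒵 → 𝒳̃` (Shannon strategies), `P_K(x,j,y,z,u) = P_X(x) Q(j|x) W(y,z|x,j) K(u|y)`,
`Δ(K)` the average distortion, and
`F(D) = inf { I_{P_K}(U;Y|Z) : K conditional pmf from 𝒴 to 𝒰, Δ(K) ≤ D }` (inf ∅ = +∞,
valued in `ℝ≥0∞`). Then `F` is non-increasing, convex in `D`, and continuous on the
interior of `{D : F(D) < ∞}`. -/
theorem stmt10 {𝒳 𝒥 𝒴 𝒵 Xt : Type*}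
    [Fintype 𝒳] [Fintype 𝒥] [Fintype 𝒴] [Fintype 𝒵] [Fintype Xt] [DecidableEq 𝒵]
    (PX : 𝒳 → ℝ) (hPX0 : ∀ x, 0 ≤ PX x) (hPX1 : ∑ x, PX x = 1)
    (Q : 𝒳 → 𝒥 → ℝ) (hQ0 : ∀ x j, 0 ≤ Q x j) (hQ1 : ∀ x, ∑ j, Q x j = 1)
    (W : 𝒳 → 𝒥 → 𝒴 → 𝒵 → ℝ) (hW0 : ∀ x j y z, 0 ≤ W x j y z)
    (hW1 : ∀ x j, ∑ y, ∑ z, W x j y z = 1)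
    (d : 𝒳 → Xt → ℝ) (hd : ∀ x xh, 0 ≤ d x xh)
    (F : ℝ → ℝ≥0∞)
    (hF : ∀ D, F D = sInf {v : ℝ≥0∞ | ∃ K : 𝒴 → (𝒵 → Xt) → ℝ,
        (∀ y u, 0 ≤ K y u) ∧ (∀ y, ∑ u, K y u = 1) ∧
        (∑ x, ∑ j, ∑ y, ∑ z, ∑ u : 𝒵 → Xt,
            PX x * Q x j * W x j y z * K y u * d x (u z)) ≤ D ∧
        v = ENNReal.ofReal
          (cmi (fun (u : 𝒵 → Xt) y z => ∑ x, ∑ j, PX x * Q x j * W x j y z * K y u))}) :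
    (∀ D₁ D₂ : ℝ, D₁ ≤ D₂ → F D₂ ≤ F D₁) ∧
    (∀ (D₁ D₂ : ℝ) (t : ℝ), 0 ≤ t → t ≤ 1 →
      F (t * D₁ + (1 - t) * D₂) ≤ ENNReal.ofReal t * F D₁ + ENNReal.ofReal (1 - t) * F D₂) ∧
    ContinuousOn F (interior {D : ℝ | F D < ⊤}) := by
  have hconv : ∀ (D₁ D₂ : ℝ) (t : ℝ), 0 ≤ t → t ≤ 1 →
      F (t * D₁ + (1 - t) * D₂) ≤
        ENNReal.ofReal t * F D₁ + ENNReal.ofReal (1 - t) * F D₂ := by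
    intro D₁ D₂ t ht0 ht1
    rcases ht0.eq_or_lt with rfl | ht
    · simp
    rcases ht1.eq_or_lt with rfl | ht1'
    · simp
    have hs : 0 < 1 - t := by linarith
    rw [hF D₁, hF D₂]
    refine le_mul_sInf_add_mul_sInf (ENNReal.ofReal_pos.2 ht).ne' ENNReal.ofReal_ne_top
      (ENNReal.ofReal_pos.2 hs).ne' ENNReal.ofReal_ne_top ?_
    rintro _ ⟨K₁, h0₁, h1₁, hd₁, rfl⟩ _ ⟨K₂, h0₂, h1₂, hd₂, rfl⟩
    rw [hF, ← ENNReal.ofReal_mul ht.le, ← ENNReal.ofReal_mul hs.le]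
    refine le_trans (b := ENNReal.ofReal (cmi fun (u : 𝒵 → Xt) y z =>
        ∑ x, ∑ j, PX x * Q x j * W x j y z * (t * K₁ y u + (1 - t) * K₂ y u)))
      (sInf_le ⟨fun y u => t * K₁ y u + (1 - t) * K₂ y u, fun y u => ?_, fun y => ?_, ?_, rfl⟩)
      ((ENNReal.ofReal_le_ofReal ?_).trans ENNReal.ofReal_add_le)
    · exact add_nonneg (mul_nonneg ht.le (h0₁ y u)) (mul_nonneg hs.le (h0₂ y u))
    · rw [sum_add_distrib, ← mul_sum, ← mul_sum, h1₁, h1₂]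
      ring
    · refine le_trans (le_of_eq ?_) (add_le_add (mul_le_mul_of_nonneg_left hd₁ ht.le)
        (mul_le_mul_of_nonneg_left hd₂ hs.le))
      simp only [mul_sum, ← sum_add_distrib]
      congr! 5
      ring
    · have hnn : ∀ K : 𝒴 → (𝒵 → Xt) → ℝ, (∀ y u, 0 ≤ K y u) → ∀ u y z,
          0 ≤ ∑ x, ∑ j, PX x * Q x j * W x j y z * K y u := fun K hK u y z =>
        sum_nonneg fun x _ => sum_nonneg fun j _ =>
          mul_nonneg (mul_nonneg (mul_nonneg (hPX0 x) (hQ0 x j)) (hW0 x j y z)) (hK y u)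
      have hmarg : ∀ K : 𝒴 → (𝒵 → Xt) → ℝ, (∀ y, ∑ u, K y u = 1) → ∀ y z,
          ∑ u, ∑ x, ∑ j, PX x * Q x j * W x j y z * K y u =
            ∑ x, ∑ j, PX x * Q x j * W x j y z := fun K hK y z => by
        simp only [← sum_mul, ← mul_sum, hK, mul_one]
      refine le_trans (le_of_eq ?_) (cmi_convex (hnn K₁ h0₁) (hnn K₂ h0₂)
        (fun y z => (hmarg K₁ h1₁ y z).trans (hmarg K₂ h1₂ y z).symm) ht hs (by ring))
      congr 1
      funext u y z
      simp only [mul_sum, ← sum_add_distrib]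
      congr! 2
      ring
  refine ⟨fun D₁ D₂ h => ?_, hconv, continuousOn_interior_of_convex hconv⟩
  rw [hF D₁, hF D₂]
  exact sInf_le_sInf fun v ⟨K, h0, h1, hd, hv⟩ => ⟨K, h0, h1, hd.trans h, hv⟩
end

section
/- (Refined Markov lemma.) For all finite sets 𝒳, 𝒴, 𝒵 and every function g : ℝ₊ → ℝ₊ with g(t) → 0 as t → 0⁺, there exists a function δ : ℝ₊ → ℝ₊ with δ(t) → 0 as t → 0⁺ such that: for every δ₀ > 0 and every conditional pmf P_{Z|Y} from 𝒴 to 𝒵 there exists K > 0 (depending only on δ₀, g, P_{Z|Y} and the alphabets) with the following property. For every n, every ε > 0, every pmf P on 𝒳 × 𝒴 × 𝒵 of the Markov form P(x,y,z) = P_Y(y)·P_{X|Y}(x|y)·P_{Z|Y}(z|y), every pair (x,y) ∈ T^n_{δ₀}(P_{X,Y}), and every 𝒵^n-valued random vector Z with distribution P_Z^(n) satisfying (a) Pr( (y, Z) ∉ T^n_{δ₀}(P_{Y,Z}) ) ≤ ε, and (b) P_Z^(n)(z) ≤ 2^{−n(H(Z|Y) − g(δ₀))} for every z ∈ 𝒵^n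 with (y,z) ∈ T^n_{δ₀}(P_{Y,Z}), where H(Z|Y) is the conditional entropy computed under P, it holds that Pr( (x, y, Z) ∉ T^n_{δ(δ₀)}(P) ) ≤ 2|𝒳||𝒴||𝒵|·e^{−nK} + ε. -/
open scoped Classical
open Finset

/-- The joint type of a triple of sequences. -/
noncomputable def empDist3 {𝒳 𝒴 𝒵 : Type*} [Fintype 𝒳] [Fintype 𝒴] [Fintype 𝒵] {n : ℕ}
    (a : Fin n → 𝒳) (b : Fin n → 𝒴) (c : Fin n → 𝒵) (α : 𝒳) (β : 𝒴) (γ : 𝒵) : ℝ :=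
  ((univ.filter (fun i => a i = α ∧ b i = β ∧ c i = γ)).card : ℝ) / n

lemma natCast_mul_empDist2 {𝒳 𝒴 : Type*} [Fintype 𝒳] [Fintype 𝒴] {n : ℕ}
    (a : Fin n → 𝒳) (b : Fin n → 𝒴) (α : 𝒳) (β : 𝒴) :
    (n : ℝ) * empDist2 a b α β = ∑ i, if a i = α ∧ b i = β then 1 else 0 := by
  rw [Finset.sum_boole, empDist2]
  rcases Nat.eq_zero_or_pos n with rfl | hn
  · simp
  · field_simp

lemma natCast_mul_empDist3 {𝒳 𝒴 𝒵 : Type*} [Fintype 𝒳] [Fintype 𝒴] [Fintype 𝒵] {n : ℕ}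
    (a : Fin n → 𝒳) (b : Fin n → 𝒴) (c : Fin n → 𝒵) (α : 𝒳) (β : 𝒴) (γ : 𝒵) :
    (n : ℝ) * empDist3 a b c α β γ =
      ∑ i, if a i = α ∧ b i = β ∧ c i = γ then 1 else 0 := by
  rw [Finset.sum_boole, empDist3]
  rcases Nat.eq_zero_or_pos n with rfl | hn
  · simp
  · field_simp

lemma empDist3_nonneg {𝒳 𝒴 𝒵 : Type*} [Fintype 𝒳] [Fintype 𝒴] [Fintype 𝒵] {n : ℕ}
    (a : Fin n → 𝒳) (b : Fin n → 𝒴) (c : Fin n → 𝒵) (α : 𝒳) (β : 𝒴) (γ : 𝒵) :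
    0 ≤ empDist3 a b c α β γ := by
  unfold empDist3; positivity

lemma empDist3_le_one {𝒳 𝒴 𝒵 : Type*} [Fintype 𝒳] [Fintype 𝒴] [Fintype 𝒵] {n : ℕ}
    (a : Fin n → 𝒳) (b : Fin n → 𝒴) (c : Fin n → 𝒵) (α : 𝒳) (β : 𝒴) (γ : 𝒵) :
    empDist3 a b c α β γ ≤ 1 := by
  unfold empDist3
  refine div_le_one_of_le₀ ?_ (Nat.cast_nonneg n)
  exact_mod_cast (Finset.card_le_univ _).trans (Fintype.card_fin n).le

/-- A sum along a pair of sequences, grouped by the value of the pair. -/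
lemma sum_comp_eq_natCast_mul_sum_empDist2 {𝒴 𝒵 : Type*} [Fintype 𝒴] [Fintype 𝒵] {n : ℕ}
    (y : Fin n → 𝒴) (z : Fin n → 𝒵) (F : 𝒴 → 𝒵 → ℝ) :
    ∑ i, F (y i) (z i) = (n : ℝ) * ∑ b, ∑ c, empDist2 y z b c * F b c := by
  simp_rw [Finset.mul_sum, ← mul_assoc, natCast_mul_empDist2, Finset.sum_mul]
  have h : ∀ b, ∑ c, ∑ i, (if y i = b ∧ z i = c then (1 : ℝ) else 0) * F b c
      = ∑ i, ∑ c, (if y i = b ∧ z i = c then (1 : ℝ) else 0) * F b c :=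
    fun b => Finset.sum_comm
  simp_rw [h]
  rw [Finset.sum_comm]
  refine Finset.sum_congr rfl fun i _ => ?_
  simp [ite_and, Finset.sum_ite_eq]

/-- Expectation of a product of coordinate functions under a product of weights. -/
lemma sum_prod_weights_mul_exp {𝒵 : Type*} [Fintype 𝒵] {n : ℕ}
    (q f : Fin n → 𝒵 → ℝ) (l : ℝ) :
    ∑ z : Fin n → 𝒵, (∏ i, q i (z i)) * Real.exp (l * ∑ i, f i (z i))
      = ∏ i, ∑ c, q i c * Real.exp (l * f i c) := by
  rw [Finset.prod_univ_sum, Fintype.piFinset_univ]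
  refine Finset.sum_congr rfl fun z _ => ?_
  rw [Finset.mul_sum, Real.exp_sum, Finset.prod_mul_distrib]

/-- One-sided Chernoff bound for a sum of independent centered variables bounded by one. -/
lemma sum_prod_weights_upper_tail_le {𝒵 : Type*} [Fintype 𝒵] {n : ℕ}
    (q f : Fin n → 𝒵 → ℝ) (hq : ∀ i c, 0 ≤ q i c) (hq1 : ∀ i, ∑ c, q i c = 1)
    (hf : ∀ i c, |f i c| ≤ 1) (hmean : ∀ i, ∑ c, q i c * f i c = 0)
    {s : ℝ} (hs0 : 0 ≤ s) (hs2 : s ≤ 2) :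
    ∑ z ∈ univ.filter (fun z : Fin n → 𝒵 => (n : ℝ) * s ≤ ∑ i, f i (z i)), ∏ i, q i (z i)
      ≤ Real.exp (-(n : ℝ) * (s ^ 2 / 4)) := by
  have hfac : ∀ i, ∑ c, q i c * Real.exp (s / 2 * f i c) ≤ Real.exp ((s / 2) ^ 2) := by
    intro i
    have hpt : ∀ c, q i c * Real.exp (s / 2 * f i c)
        ≤ q i c * (1 + (s / 2) ^ 2) + s / 2 * (q i c * f i c) := by
      intro c
      have h1 : |s / 2 * f i c| ≤ 1 := by
        rw [abs_mul, abs_of_nonneg (by positivity)]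
        exact mul_le_one₀ (by linarith) (abs_nonneg _) (hf i c)
      have h2 := (abs_le.1 (Real.abs_exp_sub_one_sub_id_le h1)).2
      have h3 : (f i c) ^ 2 ≤ 1 := (sq_le_one_iff_abs_le_one _).2 (hf i c)
      have h4 : Real.exp (s / 2 * f i c) ≤ (1 + (s / 2) ^ 2) + s / 2 * f i c := by
        nlinarith [mul_le_mul_of_nonneg_left h3 (sq_nonneg (s / 2))]
      calc _ ≤ q i c * ((1 + (s / 2) ^ 2) + s / 2 * f i c) :=
            mul_le_mul_of_nonneg_left h4 (hq i c)
        _ = _ := by ring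
    calc _ ≤ ∑ c, (q i c * (1 + (s / 2) ^ 2) + s / 2 * (q i c * f i c)) :=
          Finset.sum_le_sum fun c _ => hpt c
      _ = (s / 2) ^ 2 + 1 := by
          rw [Finset.sum_add_distrib, ← Finset.sum_mul, ← Finset.mul_sum, hq1, hmean]; ring
      _ ≤ _ := Real.add_one_le_exp _
  have hQ : ∀ z : Fin n → 𝒵, 0 ≤ ∏ i, q i (z i) := fun z =>
    Finset.prod_nonneg fun i _ => hq i _
  calc _ ≤ ∑ z ∈ univ.filter (fun z : Fin n → 𝒵 => (n : ℝ) * s ≤ ∑ i, f i (z i)),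
        (∏ i, q i (z i)) * Real.exp (s / 2 * ∑ i, f i (z i)) *
          Real.exp (-(s / 2 * (n * s))) := by
        refine Finset.sum_le_sum fun z hz => ?_
        rw [mul_assoc, ← Real.exp_add]
        refine le_mul_of_one_le_right (hQ z) (Real.one_le_exp ?_)
        have := mul_le_mul_of_nonneg_left (Finset.mem_filter.1 hz).2 (by linarith : 0 ≤ s / 2)
        linarith
    _ ≤ ∑ z : Fin n → 𝒵, (∏ i, q i (z i)) * Real.exp (s / 2 * ∑ i, f i (z i)) *
          Real.exp (-(s / 2 * (n * s))) :=
        Finset.sum_le_sum_of_subset_of_nonneg (Finset.filter_subset _ _) fun z _ _ =>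
          mul_nonneg (mul_nonneg (hQ z) (Real.exp_pos _).le) (Real.exp_pos _).le
    _ = (∏ i, ∑ c, q i c * Real.exp (s / 2 * f i c)) * Real.exp (-(s / 2 * (n * s))) := by
        rw [← Finset.sum_mul, sum_prod_weights_mul_exp]
    _ ≤ (∏ _i : Fin n, Real.exp ((s / 2) ^ 2)) * Real.exp (-(s / 2 * (n * s))) := by
        refine mul_le_mul_of_nonneg_right ?_ (Real.exp_pos _).le
        exact Finset.prod_le_prod
          (fun i _ => Finset.sum_nonneg fun c _ => mul_nonneg (hq i c) (Real.exp_pos _).le)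
          fun i _ => hfac i
    _ = _ := by
        rw [Finset.prod_const, Finset.card_univ, Fintype.card_fin, ← Real.exp_nat_mul,
          ← Real.exp_add]
        congr 1; ring

/-- Two-sided Chernoff bound for a sum of independent centered variables bounded by one. -/
lemma sum_prod_weights_tail_le {𝒵 : Type*} [Fintype 𝒵] {n : ℕ}
    (q f : Fin n → 𝒵 → ℝ) (hq : ∀ i c, 0 ≤ q i c) (hq1 : ∀ i, ∑ c, q i c = 1)
    (hf : ∀ i c, |f i c| ≤ 1) (hmean : ∀ i, ∑ c, q i c * f i c = 0)
    {s : ℝ} (hs0 : 0 ≤ s) (hs2 : s ≤ 2) :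
    ∑ z ∈ univ.filter (fun z : Fin n → 𝒵 => (n : ℝ) * s ≤ |∑ i, f i (z i)|), ∏ i, q i (z i)
      ≤ 2 * Real.exp (-(n : ℝ) * (s ^ 2 / 4)) := by
  have hQ : ∀ z : Fin n → 𝒵, 0 ≤ ∏ i, q i (z i) := fun z =>
    Finset.prod_nonneg fun i _ => hq i _
  have h1 := sum_prod_weights_upper_tail_le q f hq hq1 hf hmean hs0 hs2
  have h2 := sum_prod_weights_upper_tail_le q (fun i c => -f i c) hq hq1
    (by simpa using hf) (by simpa using hmean) hs0 hs2
  simp only [Finset.sum_neg_distrib] at h2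
  have h3 : univ.filter (fun z : Fin n → 𝒵 => (n : ℝ) * s ≤ |∑ i, f i (z i)|)
      = univ.filter (fun z : Fin n → 𝒵 => (n : ℝ) * s ≤ ∑ i, f i (z i)) ∪
        univ.filter (fun z : Fin n → 𝒵 => (n : ℝ) * s ≤ -∑ i, f i (z i)) := by
    ext z; simp [le_abs]
  rw [h3]
  have h4 := Finset.sum_union_inter
    (s₁ := univ.filter (fun z : Fin n → 𝒵 => (n : ℝ) * s ≤ ∑ i, f i (z i)))
    (s₂ := univ.filter (fun z : Fin n → 𝒵 => (n : ℝ) * s ≤ -∑ i, f i (z i)))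
    (f := fun z => ∏ i, q i (z i))
  have h5 := Finset.sum_nonneg (s := univ.filter (fun z : Fin n → 𝒵 => (n : ℝ) * s ≤
    ∑ i, f i (z i)) ∩ univ.filter (fun z : Fin n → 𝒵 => (n : ℝ) * s ≤ -∑ i, f i (z i)))
    (f := fun z => ∏ i, q i (z i)) fun z _ => hQ z
  linarith

/-- Concentration of the joint type of `(x, y, Z)` when the `Z i` are independent with laws
`q (y i)`. -/
lemma sum_empDist3_deviation_le {𝒳 𝒴 𝒵 : Type*} [Fintype 𝒳] [Fintype 𝒴] [Fintype 𝒵] {n : ℕ}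
    (x : Fin n → 𝒳) (y : Fin n → 𝒴) (q : 𝒴 → 𝒵 → ℝ) (hq : ∀ b c, 0 ≤ q b c)
    (hq1 : ∀ b, ∑ c, q b c = 1) {s : ℝ} (hs0 : 0 ≤ s) (hs2 : s ≤ 2) (a : 𝒳) (b : 𝒴) (c : 𝒵) :
    ∑ z ∈ univ.filter (fun z : Fin n → 𝒵 =>
        s < |empDist3 x y z a b c - empDist2 x y a b * q b c|), ∏ i, q (y i) (z i)
      ≤ 2 * Real.exp (-(n : ℝ) * (s ^ 2 / 4)) := by
  set f : Fin n → 𝒵 → ℝ := fun i c' =>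
    if x i = a ∧ y i = b then (if c' = c then 1 else 0) - q b c else 0 with hfdef
  have hqle : q b c ≤ 1 := by
    rw [← hq1 b]
    exact Finset.single_le_sum (fun c' _ => hq b c') (Finset.mem_univ c)
  have hf : ∀ i c', |f i c'| ≤ 1 := by
    intro i c'
    have := hq b c
    simp only [hfdef]
    split_ifs <;> rw [abs_le] <;> constructor <;> linarith
  have hmean : ∀ i, ∑ c', q (y i) c' * f i c' = 0 := by
    intro i
    by_cases h : x i = a ∧ y i = b
    · simp only [hfdef, if_pos h, h.2, mul_sub, Finset.sum_sub_distrib, ← Finset.sum_mul, hq1]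
      simp
    · simp [hfdef, if_neg h]
  refine le_trans ?_ (sum_prod_weights_tail_le (fun i => q (y i)) f (fun i => hq _)
    (fun i => hq1 _) hf hmean hs0 hs2)
  refine Finset.sum_le_sum_of_subset_of_nonneg ?_ fun z _ _ =>
    Finset.prod_nonneg fun i _ => hq _ _
  intro z hz
  simp only [Finset.mem_filter, Finset.mem_univ, true_and] at hz ⊢
  have hsum : ∑ i, f i (z i) = n * (empDist3 x y z a b c - empDist2 x y a b * q b c) := by
    rw [mul_sub, ← mul_assoc, natCast_mul_empDist2, natCast_mul_empDist3, Finset.sum_mul,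
      ← Finset.sum_sub_distrib]
    refine Finset.sum_congr rfl fun i _ => ?_
    simp only [hfdef]
    by_cases h1 : x i = a <;> by_cases h2 : y i = b <;> simp [h1, h2]
  rw [hsum, abs_mul, Nat.abs_cast]
  exact mul_le_mul_of_nonneg_left hz.le (Nat.cast_nonneg n)

/-- Chain rule for the entropy of a pair with marginal `p` and conditional law `w`. -/
lemma ent_mul_sub_ent {𝒴 𝒵 : Type*} [Fintype 𝒴] [Fintype 𝒵] (p : 𝒴 → ℝ) (w : 𝒴 → 𝒵 → ℝ)
    (hw1 : ∀ b, ∑ c, w b c = 1) :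
    ent (fun r : 𝒴 × 𝒵 => p r.1 * w r.1 r.2) - ent p
      = -∑ b, ∑ c, p b * w b c * Real.logb 2 (w b c) := by
  unfold ent
  rw [Fintype.sum_prod_type]
  have h : ∀ b, ∑ c, p b * w b c * Real.logb 2 (p b * w b c)
      = p b * Real.logb 2 (p b) + ∑ c, p b * w b c * Real.logb 2 (w b c) := by
    intro b
    have h1 : p b * Real.logb 2 (p b) = ∑ c, p b * Real.logb 2 (p b) * w b c := by
      rw [← Finset.mul_sum, hw1, mul_one]
    rw [h1, ← Finset.sum_add_distrib]
    refine Finset.sum_congr rfl fun c _ => ?_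
    by_cases hp : p b = 0
    · simp [hp]
    by_cases hwc : w b c = 0
    · simp [hwc]
    rw [Real.logb_mul hp hwc]; ring
  simp only [h, Finset.sum_add_distrib]
  ring

/-- Lower bound for the likelihood of a typical sequence under the smoothed conditional law
`(1 - t) w + t / |𝒵|`. -/
lemma exp_le_prod_smoothed {𝒴 𝒵 : Type*} [Fintype 𝒴] [Fintype 𝒵] [Nonempty 𝒵] {n : ℕ}
    (p : 𝒴 → ℝ) (w : 𝒴 → 𝒵 → ℝ) (hp : ∀ b, 0 ≤ p b) (hp1 : ∑ b, p b = 1)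
    (hw : ∀ b c, 0 ≤ w b c) (hw1 : ∀ b, ∑ c, w b c = 1) {t : ℝ} (ht : 0 < t) (ht2 : t ≤ 1 / 2)
    (y : Fin n → 𝒴) (z : Fin n → 𝒵) (hT : ∀ b c, empDist2 y z b c ≤ p b * w b c + t) :
    Real.exp (n * (∑ b, ∑ c, p b * w b c * Real.log (w b c) - 2 * t
        - (Fintype.card 𝒴 * Fintype.card 𝒵 : ℝ) * (t * Real.log (Fintype.card 𝒵) - t * Real.log t)))
      ≤ ∏ i, ((1 - t) * w (y i) (z i) + t / Fintype.card 𝒵) := by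
  set N : ℝ := (Fintype.card 𝒵 : ℝ) with hN
  have hN1 : (1 : ℝ) ≤ N := by
    rw [hN]; exact_mod_cast Fintype.card_pos
  set q : 𝒴 → 𝒵 → ℝ := fun b c => (1 - t) * w b c + t / N with hqdef
  have htN : 0 < t / N := by positivity
  have hlow : ∀ b c, t / N ≤ q b c := fun b c => by
    have := mul_nonneg (by linarith : 0 ≤ 1 - t) (hw b c)
    simp only [hqdef]; linarith
  have hqpos : ∀ b c, 0 < q b c := fun b c => htN.trans_le (hlow b c)
  have hwle : ∀ b c, w b c ≤ 1 := fun b c => by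
    rw [← hw1 b]
    exact Finset.single_le_sum (fun c' _ => hw b c') (Finset.mem_univ c)
  have hqle : ∀ b c, q b c ≤ 1 := fun b c => by
    have h1 := mul_le_mul_of_nonneg_left (hwle b c) (by linarith : 0 ≤ 1 - t)
    have h2 : t / N ≤ t := div_le_self ht.le hN1
    simp only [hqdef]; linarith
  have hloglow : ∀ b c, Real.log t - Real.log N ≤ Real.log (q b c) := fun b c => by
    rw [← Real.log_div ht.ne' (by linarith)]
    exact Real.log_le_log htN (hlow b c)
  have hlog1 : -(2 * t) ≤ Real.log (1 - t) := by
    have h1 := Real.one_sub_inv_le_log_of_pos (by linarith : 0 < 1 - t)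
    have h2 : (1 - t)⁻¹ ≤ 1 + 2 * t := by
      rw [inv_le_iff_one_le_mul₀ (by linarith)]
      nlinarith
    linarith
  have hcell : ∀ b c, p b * w b c * Real.log (w b c) - p b * w b c * (2 * t)
      - (t * Real.log N - t * Real.log t) ≤ empDist2 y z b c * Real.log (q b c) := by
    intro b c
    have h0 : Real.log (q b c) ≤ 0 := Real.log_nonpos (hqpos b c).le (hqle b c)
    have h1 := mul_le_mul_of_nonpos_right (hT b c) h0
    have h2 := mul_le_mul_of_nonneg_left (hloglow b c) ht.le
    have h3 : p b * w b c * Real.log (w b c) - p b * w b c * (2 * t)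
        ≤ p b * w b c * Real.log (q b c) := by
      rcases (hw b c).eq_or_lt with h | h
      · simp [← h]
      · have h4 : Real.log (w b c) - 2 * t ≤ Real.log (q b c) := by
          have h5 : Real.log ((1 - t) * w b c) ≤ Real.log (q b c) :=
            Real.log_le_log (mul_pos (by linarith) h) (by simp only [hqdef]; linarith)
          rw [Real.log_mul (by linarith) h.ne'] at h5
          linarith
        have := mul_le_mul_of_nonneg_left h4 (mul_nonneg (hp b) h.le)
        linarith
    linarith
  have hmass : ∑ b, ∑ c, p b * w b c * (2 * t) = 2 * t := by
    simp_rw [← Finset.sum_mul, ← Finset.mul_sum, hw1, mul_one, hp1, one_mul]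
  have hsum := Finset.sum_le_sum fun b (_ : b ∈ univ) =>
    Finset.sum_le_sum fun c (_ : c ∈ univ) => hcell b c
  simp only [Finset.sum_sub_distrib, hmass] at hsum
  have hprod : ∏ i, q (y i) (z i)
      = Real.exp (n * ∑ b, ∑ c, empDist2 y z b c * Real.log (q b c)) := by
    rw [← sum_comp_eq_natCast_mul_sum_empDist2 y z fun b c => Real.log (q b c), Real.exp_sum]
    exact Finset.prod_congr rfl fun i _ => (Real.exp_log (hqpos _ _)).symm
  change _ ≤ ∏ i, q (y i) (z i)
  rw [hprod]
  refine Real.exp_le_exp.2 (mul_le_mul_of_nonneg_left (le_trans (le_of_eq ?_) hsum)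
    (Nat.cast_nonneg n))
  simp only [Finset.sum_const, Finset.card_univ, nsmul_eq_mul, ← hN]
  ring

/-- Refined Markov lemma. For all finite alphabets `𝒳, 𝒴, 𝒵` and every
`g : ℝ₊ → ℝ₊` with `g(t) → 0` as `t → 0⁺`, there is `δ : ℝ₊ → ℝ₊` with `δ(t) → 0` as
`t → 0⁺` such that for every `δ₀ > 0` and conditional pmf `P_{Z|Y}` there is `K > 0`
(depending only on `δ₀`, `g`, `P_{Z|Y}` and the alphabets) with: for every `n`, `ε > 0`,
pmf `P` of Markov form `P(x,y,z) = P_{X,Y}(x,y)·P_{Z|Y}(z|y)`, pair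
`(x,y) ∈ T^n_{δ₀}(P_{X,Y})` and `𝒵^n`-valued random vector `Z ∼ P_Z⁽ⁿ⁾` satisfying
(a) `Pr((y,Z) ∉ T^n_{δ₀}(P_{Y,Z})) ≤ ε` and
(b) `P_Z⁽ⁿ⁾(z) ≤ 2^{−n(H(Z|Y) − g(δ₀))}` for every `z` with `(y,z) ∈ T^n_{δ₀}(P_{Y,Z})`,
one has `Pr((x,y,Z) ∉ T^n_{δ(δ₀)}(P)) ≤ 2|𝒳||𝒴||𝒵| e^{−nK} + ε`. -/
theorem stmt11 {𝒳 𝒴 𝒵 : Type*} [Fintype 𝒳] [Fintype 𝒴] [Fintype 𝒵]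
    (g : ℝ → ℝ) (hgpos : ∀ t, 0 < t → 0 < g t)
    (hg0 : Filter.Tendsto g (nhdsWithin 0 (Set.Ioi 0)) (nhds 0)) :
    ∃ δ : ℝ → ℝ, (∀ t, 0 < t → 0 < δ t) ∧
      Filter.Tendsto δ (nhdsWithin 0 (Set.Ioi 0)) (nhds 0) ∧
      ∀ δ₀ : ℝ, 0 < δ₀ →
      ∀ Pzy : 𝒴 → 𝒵 → ℝ, (∀ y z, 0 ≤ Pzy y z) → (∀ y, ∑ z, Pzy y z = 1) →
      ∃ K : ℝ, 0 < K ∧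
        ∀ (n : ℕ) (ε : ℝ), 0 < ε →
        ∀ P : 𝒳 → 𝒴 → 𝒵 → ℝ,
          (∀ x y z, 0 ≤ P x y z) → (∑ x, ∑ y, ∑ z, P x y z = 1) →
          (∀ x y z, P x y z = (∑ z', P x y z') * Pzy y z) →
        ∀ (x : Fin n → 𝒳) (y : Fin n → 𝒴),
          (∀ a b, |empDist2 x y a b - ∑ c, P a b c| ≤ δ₀) →
        ∀ Pz : (Fin n → 𝒵) → ℝ, (∀ z, 0 ≤ Pz z) → (∑ z, Pz z = 1) →
          (∑ z ∈ univ.filter (fun z : Fin n → 𝒵 =>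
              ¬ ∀ b c, |empDist2 y z b c - ∑ a, P a b c| ≤ δ₀), Pz z) ≤ ε →
          (∀ z : Fin n → 𝒵, (∀ b c, |empDist2 y z b c - ∑ a, P a b c| ≤ δ₀) →
            Pz z ≤ (2 : ℝ) ^ (-(n : ℝ) *
              ((ent (fun p : 𝒴 × 𝒵 => ∑ a, P a p.1 p.2)
                  - ent (fun b : 𝒴 => ∑ a, ∑ c, P a b c)) - g δ₀))) →
          (∑ z ∈ univ.filter (fun z : Fin n → 𝒵 =>
              ¬ ∀ a b c, |empDist3 x y z a b c - P a b c| ≤ δ δ₀), Pz z)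
            ≤ 2 * (Fintype.card 𝒳 : ℝ) * (Fintype.card 𝒴 : ℝ) * (Fintype.card 𝒵 : ℝ)
                * Real.exp (-(n : ℝ) * K) + ε := by
  set η : ℝ → ℝ := fun t => Real.log 2 * g t + 2 * t +
    (Fintype.card 𝒴 * Fintype.card 𝒵 : ℝ) *
      (t * Real.log (Fintype.card 𝒵) - t * Real.log t) with hη
  refine ⟨fun t => 2 * t + 2 * √(η t + t), ?_, ?_, ?_⟩
  · intro t ht
    positivity
  · have hid : Filter.Tendsto (fun t : ℝ => t) (nhdsWithin 0 (Set.Ioi 0)) (nhds 0) :=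
      tendsto_nhdsWithin_of_tendsto_nhds Filter.tendsto_id
    have hlog : Filter.Tendsto (fun t : ℝ => t * Real.log t) (nhdsWithin 0 (Set.Ioi 0))
        (nhds 0) := by
      have := Real.continuous_mul_log.tendsto 0
      simp only [zero_mul] at this
      exact tendsto_nhdsWithin_of_tendsto_nhds this
    have hη0 : Filter.Tendsto η (nhdsWithin 0 (Set.Ioi 0)) (nhds 0) := by
      have := ((hg0.const_mul (Real.log 2)).add (hid.const_mul 2)).add
        (((hid.mul_const (Real.log (Fintype.card 𝒵))).sub hlog).const_mul
          (Fintype.card 𝒴 * Fintype.card 𝒵 : ℝ))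
      simpa using this
    have := (hid.const_mul 2).add ((hη0.add hid).sqrt.const_mul 2)
    simpa using this
  intro δ₀ hδ₀ w hw hw1
  refine ⟨δ₀, hδ₀, ?_⟩
  intro n ε hε P hP hP1 hPw x y hxy Pz hPz hPz1 ha hb
  have hPle : ∀ a b c, P a b c ≤ 1 := by
    intro a b c
    rw [← hP1]
    refine le_trans ?_ (Finset.single_le_sum
      (fun a' _ => Finset.sum_nonneg fun b' _ => Finset.sum_nonneg fun c' _ => hP a' b' c')
      (Finset.mem_univ a))
    refine le_trans ?_ (Finset.single_le_sum
      (fun b' _ => Finset.sum_nonneg fun c' _ => hP a b' c') (Finset.mem_univ b))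
    exact Finset.single_le_sum (fun c' _ => hP a b c') (Finset.mem_univ c)
  by_cases hbig : 1 ≤ 2 * δ₀ + 2 * √(η δ₀ + δ₀)
  · rw [Finset.filter_false_of_mem, Finset.sum_empty]
    · positivity
    · intro z _
      rw [not_not]
      intro a b c
      refine le_trans ?_ hbig
      have h1 := empDist3_nonneg x y z a b c
      have h2 := empDist3_le_one x y z a b c
      have h3 := hP a b c
      have h4 := hPle a b c
      rw [abs_le]; constructor <;> linarith
  push Not at hbig
  set s : ℝ := 2 * √(η δ₀ + δ₀) with hs
  have hs0 : 0 ≤ s := by positivity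
  have hδ2 : δ₀ ≤ 1 / 2 := by linarith
  have : Nonempty 𝒵 := by
    by_contra hne
    rw [not_nonempty_iff] at hne
    simp at hP1
  have hN1 : (1 : ℝ) ≤ Fintype.card 𝒵 := by exact_mod_cast Fintype.card_pos
  have hη0 : 0 ≤ η δ₀ := by
    have h1 := mul_pos (Real.log_pos one_lt_two) (hgpos δ₀ hδ₀)
    have h2 := mul_nonneg hδ₀.le (Real.log_nonneg hN1)
    have h3 := mul_nonpos_of_nonneg_of_nonpos hδ₀.le
      (Real.log_nonpos hδ₀.le (by linarith))
    have h4 := mul_nonneg (by positivity : (0 : ℝ) ≤ Fintype.card 𝒴 * Fintype.card 𝒵)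
      (by linarith : 0 ≤ δ₀ * Real.log (Fintype.card 𝒵) - δ₀ * Real.log δ₀)
    simp only [hη]
    linarith
  have hs2 : s ^ 2 / 4 = η δ₀ + δ₀ := by
    rw [hs, mul_pow, Real.sq_sqrt (by linarith)]; ring
  set p : 𝒴 → ℝ := fun b => ∑ a, ∑ c, P a b c with hpdef
  have hp : ∀ b, 0 ≤ p b := fun b =>
    Finset.sum_nonneg fun a _ => Finset.sum_nonneg fun c _ => hP a b c
  have hp1 : ∑ b, p b = 1 := by rw [← hP1, Finset.sum_comm]
  have hpw : ∀ b c, ∑ a, P a b c = p b * w b c := by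
    intro b c
    rw [hpdef, Finset.sum_mul]
    exact Finset.sum_congr rfl fun a _ => hPw a b c
  simp only [hpw] at ha hb
  have hent := ent_mul_sub_ent p w hw1
  rw [hent] at hb
  set q : 𝒴 → 𝒵 → ℝ := fun b c => (1 - δ₀) * w b c + δ₀ / Fintype.card 𝒵 with hqdef
  have hq : ∀ b c, 0 ≤ q b c := fun b c =>
    add_nonneg (mul_nonneg (by linarith) (hw b c)) (by positivity)
  have hq1 : ∀ b, ∑ c, q b c = 1 := fun b => by
    simp only [hqdef, Finset.sum_add_distrib, ← Finset.mul_sum, hw1, Finset.sum_const,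
      Finset.card_univ, nsmul_eq_mul]
    field_simp
    ring
  have hqle : ∀ b c, q b c ≤ 1 := fun b c => by
    rw [← hq1 b]
    exact Finset.single_le_sum (fun c' _ => hq b c') (Finset.mem_univ c)
  have hwle : ∀ b c, w b c ≤ 1 := fun b c => by
    rw [← hw1 b]
    exact Finset.single_le_sum (fun c' _ => hw b c') (Finset.mem_univ c)
  have hqw : ∀ b c, |q b c - w b c| ≤ δ₀ := fun b c => by
    have h1 : q b c - w b c = δ₀ * (1 / Fintype.card 𝒵 - w b c) := by
      simp only [hqdef]; ring
    have h2 : (1 : ℝ) / Fintype.card 𝒵 ≤ 1 := by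
      rw [div_le_one (by linarith)]; exact hN1
    have h3 : (0 : ℝ) ≤ 1 / Fintype.card 𝒵 := by positivity
    rw [h1, abs_mul, abs_of_pos hδ₀]
    refine mul_le_of_le_one_right hδ₀.le ?_
    have h4 := hw b c
    have h5 := hwle b c
    rw [abs_le]; constructor <;> linarith
  have hdom : ∀ z : Fin n → 𝒵, (∀ b c, |empDist2 y z b c - p b * w b c| ≤ δ₀) →
      Pz z ≤ Real.exp (n * η δ₀) * ∏ i, q (y i) (z i) := by
    intro z hz
    have h1 := exp_le_prod_smoothed p w hp hp1 hw hw1 hδ₀ hδ2 y z fun b c => by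
      have := (abs_le.1 (hz b c)).2
      linarith
    refine (hb z hz).trans (le_trans (le_of_eq ?_)
      (mul_le_mul_of_nonneg_left h1 (Real.exp_pos (n * η δ₀)).le))
    have h2 : ∑ b, ∑ c, p b * w b c * Real.log (w b c)
        = Real.log 2 * ∑ b, ∑ c, p b * w b c * Real.logb 2 (w b c) := by
      simp_rw [Finset.mul_sum]
      refine Finset.sum_congr rfl fun b _ => Finset.sum_congr rfl fun c _ => ?_
      rw [Real.logb]
      have : Real.log 2 ≠ 0 := (Real.log_pos one_lt_two).ne'
      field_simp
    rw [← Real.exp_add, h2, Real.rpow_def_of_pos two_pos]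
    congr 1
    simp only [hη]
    ring
  have hdev : ∀ (z : Fin n → 𝒵) a b c, 2 * δ₀ + s < |empDist3 x y z a b c - P a b c| →
      s < |empDist3 x y z a b c - empDist2 x y a b * q b c| := by
    intro z a b c h
    set r := ∑ c', P a b c' with hr
    have hr0 : 0 ≤ r := Finset.sum_nonneg fun c' _ => hP a b c'
    have hr1 : r ≤ 1 := by
      rw [← hP1]
      refine le_trans ?_ (Finset.single_le_sum
        (fun a' _ => Finset.sum_nonneg fun b' _ => Finset.sum_nonneg fun c' _ => hP a' b' c')
        (Finset.mem_univ a))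
      exact Finset.single_le_sum
        (fun b' _ => Finset.sum_nonneg fun c' _ => hP a b' c') (Finset.mem_univ b)
    have h1 : |(empDist2 x y a b - r) * q b c| ≤ δ₀ := by
      rw [abs_mul, abs_of_nonneg (hq b c)]
      exact (mul_le_of_le_one_right (abs_nonneg _) (hqle b c)).trans (hxy a b)
    have h2 : |r * (q b c - w b c)| ≤ δ₀ := by
      rw [abs_mul, abs_of_nonneg hr0]
      exact (mul_le_of_le_one_left (abs_nonneg _) hr1).trans (hqw b c)
    have h3 : empDist3 x y z a b c - P a b c
        = (empDist3 x y z a b c - empDist2 x y a b * q b c)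
          + (empDist2 x y a b - r) * q b c + r * (q b c - w b c) := by
      rw [hPw a b c]; ring
    rw [h3] at h
    have h4 := abs_add_three (empDist3 x y z a b c - empDist2 x y a b * q b c)
      ((empDist2 x y a b - r) * q b c) (r * (q b c - w b c))
    linarith
  have hQ : ∀ z : Fin n → 𝒵, 0 ≤ ∏ i, q (y i) (z i) := fun z =>
    Finset.prod_nonneg fun i _ => hq _ _
  set D : 𝒳 × 𝒴 × 𝒵 → Finset (Fin n → 𝒵) := fun r => univ.filter (fun z : Fin n → 𝒵 =>
    s < |empDist3 x y z r.1 r.2.1 r.2.2 - empDist2 x y r.1 r.2.1 * q r.2.1 r.2.2|) with hD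
  have hpoint : ∀ z ∈ univ.filter (fun z : Fin n → 𝒵 =>
      ¬ ∀ a b c, |empDist3 x y z a b c - P a b c| ≤ 2 * δ₀ + s),
      Pz z ≤ Real.exp (n * η δ₀) * ∑ r, (if z ∈ D r then ∏ i, q (y i) (z i) else 0)
        + (if ¬ ∀ b c, |empDist2 y z b c - p b * w b c| ≤ δ₀ then Pz z else 0) := by
    intro z hz
    have hnn : ∀ r, 0 ≤ (if z ∈ D r then ∏ i, q (y i) (z i) else 0) := fun r => by
      split_ifs
      · exact hQ z
      · exact le_rfl
    by_cases htyp : ∀ b c, |empDist2 y z b c - p b * w b c| ≤ δ₀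
    · rw [if_neg (not_not.2 htyp), add_zero]
      refine (hdom z htyp).trans (mul_le_mul_of_nonneg_left ?_ (Real.exp_pos _).le)
      have hz' := (Finset.mem_filter.1 hz).2
      push Not at hz'
      obtain ⟨a, b, c, habc⟩ := hz'
      have hmem : z ∈ D (a, b, c) :=
        Finset.mem_filter.2 ⟨Finset.mem_univ z, hdev z a b c habc⟩
      refine le_trans (le_of_eq (if_pos hmem).symm) (Finset.single_le_sum
        (f := fun r => if z ∈ D r then ∏ i, q (y i) (z i) else 0)
        (fun r _ => hnn r) (Finset.mem_univ (a, b, c)))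
    · rw [if_pos htyp]
      exact le_add_of_nonneg_left
        (mul_nonneg (Real.exp_pos _).le (Finset.sum_nonneg fun r _ => hnn r))
  calc _ ≤ ∑ z ∈ univ.filter (fun z : Fin n → 𝒵 =>
        ¬ ∀ a b c, |empDist3 x y z a b c - P a b c| ≤ 2 * δ₀ + s),
        (Real.exp (n * η δ₀) * ∑ r, (if z ∈ D r then ∏ i, q (y i) (z i) else 0)
        + (if ¬ ∀ b c, |empDist2 y z b c - p b * w b c| ≤ δ₀ then Pz z else 0)) :=
        Finset.sum_le_sum hpoint
    _ ≤ ∑ z : Fin n → 𝒵,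
        (Real.exp (n * η δ₀) * ∑ r, (if z ∈ D r then ∏ i, q (y i) (z i) else 0)
        + (if ¬ ∀ b c, |empDist2 y z b c - p b * w b c| ≤ δ₀ then Pz z else 0)) := by
        refine Finset.sum_le_sum_of_subset_of_nonneg (Finset.filter_subset _ _) fun z _ _ =>
          add_nonneg (mul_nonneg (Real.exp_pos _).le (Finset.sum_nonneg fun r _ => ?_)) ?_
        · split_ifs
          · exact hQ z
          · exact le_rfl
        · split_ifs
          · exact le_rfl
          · exact hPz z
    _ = Real.exp (n * η δ₀) * ∑ r, ∑ z ∈ D r, ∏ i, q (y i) (z i)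
        + ∑ z ∈ univ.filter (fun z : Fin n → 𝒵 =>
            ¬ ∀ b c, |empDist2 y z b c - p b * w b c| ≤ δ₀), Pz z := by
        rw [Finset.sum_add_distrib, ← Finset.mul_sum, Finset.sum_comm, Finset.sum_filter]
        congr 2
        refine Finset.sum_congr rfl fun r _ => ?_
        rw [Finset.sum_ite_mem, Finset.univ_inter]
    _ ≤ Real.exp (n * η δ₀) * ∑ _r : 𝒳 × 𝒴 × 𝒵, 2 * Real.exp (-(n : ℝ) * (s ^ 2 / 4)) + ε := by
        refine add_le_add (mul_le_mul_of_nonneg_left (Finset.sum_le_sum fun r _ => ?_)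
          (Real.exp_pos _).le) ha
        exact sum_empDist3_deviation_le x y q hq hq1 hs0 (by linarith) r.1 r.2.1 r.2.2
    _ = _ := by
        rw [Finset.sum_const, Finset.card_univ, Fintype.card_prod, Fintype.card_prod,
          nsmul_eq_mul, hs2]
        have h : Real.exp (-(n : ℝ) * δ₀)
            = Real.exp (n * η δ₀) * Real.exp (-(n : ℝ) * (η δ₀ + δ₀)) := by
          rw [← Real.exp_add]; congr 1; ring
        rw [h]
        push_cast
        ring
end

section
/- Let 𝒳, 𝒥, 𝒴, 𝒵, 𝒰 be finite sets, P_X a pmf on 𝒳, W a conditional pmf from 𝒳 × 𝒥 to 𝒴, P_{Z|X} a conditional pmf from 𝒳 to 𝒵, and P_{U|Y} a conditional pmf from 𝒴 to 𝒰 (this is the case where the adversary controls only the encoder observation Y). For each conditional pmf Q from 𝒳 to 𝒥 define the joint pmf P_Q(x,j,y,z,u) = P_X(x)·Q(j|x)·W(y|x,j)·P_{Z|X}(z|x)·P_{U|Y}(u|y). Then the map Q ↦ I_{P_Q}(U;Y) − I_{P_Q}(U;Z) is concave on the convex set of conditional pmfs from 𝒳 to 𝒥. -/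
open Finset

/-- Mutual information (base 2) of a joint pmf `R` on `𝒜 × ℬ`, with the convention
`0·log(·) = 0`. -/
noncomputable def mi2 {𝒜 ℬ : Type*} [Fintype 𝒜] [Fintype ℬ] (R : 𝒜 → ℬ → ℝ) : ℝ :=
  ∑ a, ∑ b, R a b * Real.logb 2 (R a b / ((∑ b', R a b') * (∑ a', R a' b)))

open Real in
/-- Mutual information of a nonnegative array as a combination of entropies. -/
theorem mi2_eq_negMulLog {𝒜 ℬ : Type*} [Fintype 𝒜] [Fintype ℬ] (R : 𝒜 → ℬ → ℝ)
    (hR : ∀ a b, 0 ≤ R a b) :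
    mi2 R = (∑ a, negMulLog (∑ b, R a b) + ∑ b, negMulLog (∑ a, R a b)
      - ∑ a, ∑ b, negMulLog (R a b)) / log 2 := by
  have hterm : ∀ a b, R a b * logb 2 (R a b / ((∑ b', R a b') * (∑ a', R a' b))) =
      (-(R a b * log (∑ b', R a b')) - R a b * log (∑ a', R a' b)
        - negMulLog (R a b)) / log 2 := by
    intro a b
    rcases (hR a b).eq_or_lt with h | h
    · simp [← h]
    · have hA : 0 < ∑ b', R a b' :=
        h.trans_le (single_le_sum (f := fun b' => R a b') (fun i _ => hR a i) (mem_univ b))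
      have hB : 0 < ∑ a', R a' b :=
        h.trans_le (single_le_sum (f := fun a' => R a' b) (fun i _ => hR i b) (mem_univ a))
      rw [logb, log_div h.ne' (mul_pos hA hB).ne', log_mul hA.ne' hB.ne', negMulLog]
      ring
  have hA : ∑ a, negMulLog (∑ b, R a b) = ∑ a, ∑ b, -(R a b * log (∑ b', R a b')) := by
    simp only [negMulLog, sum_neg_distrib, sum_mul, neg_mul]
  have hB : ∑ b, negMulLog (∑ a, R a b) = -∑ a, ∑ b, R a b * log (∑ a', R a' b) := by
    rw [sum_comm]
    simp only [negMulLog, sum_neg_distrib, sum_mul, neg_mul]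
  simp only [mi2, hterm, ← sum_div, sum_sub_distrib]
  rw [hA, hB]
  ring

open Real in
/-- For an array `p b * K b a` with stochastic `K`, the entropy of `p` cancels from the mutual
information. -/
theorem mi2_mul_kernel {𝒜 ℬ : Type*} [Fintype 𝒜] [Fintype ℬ] (p : ℬ → ℝ) (K : ℬ → 𝒜 → ℝ)
    (hp : ∀ b, 0 ≤ p b) (hK0 : ∀ b a, 0 ≤ K b a) (hK1 : ∀ b, ∑ a, K b a = 1) :
    mi2 (fun a b => p b * K b a) = (∑ a, negMulLog (∑ b, p b * K b a)
      - ∑ b, p b * ∑ a, negMulLog (K b a)) / log 2 := by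
  rw [mi2_eq_negMulLog _ fun a b => mul_nonneg (hp b) (hK0 b a)]
  have h : ∑ a, ∑ b, negMulLog (p b * K b a) =
      ∑ b, negMulLog (p b) + ∑ b, p b * ∑ a, negMulLog (K b a) := by
    rw [sum_comm, ← sum_add_distrib]
    refine sum_congr rfl fun b _ => ?_
    simp only [negMulLog_mul, sum_add_distrib, ← sum_mul, ← mul_sum, hK1, one_mul]
  simp only [← mul_sum, hK1, mul_one, h]
  ring

/-- Adversary controlling only the encoder observation `Y`: with
`P_Q(x,j,y,z,u) = P_X(x)·Q(j|x)·W(y|x,j)·P_{Z|X}(z|x)·P_{U|Y}(u|y)`, the map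
`Q ↦ I_{P_Q}(U;Y) − I_{P_Q}(U;Z)` is concave on the convex set of conditional pmfs
from `𝒳` to `𝒥`. -/
theorem stmt13 {𝒳 𝒥 𝒴 𝒵 𝒰 : Type*}
    [Fintype 𝒳] [Fintype 𝒥] [Fintype 𝒴] [Fintype 𝒵] [Fintype 𝒰]
    (PX : 𝒳 → ℝ) (hPX0 : ∀ x, 0 ≤ PX x) (hPX1 : ∑ x, PX x = 1)
    (W : 𝒳 → 𝒥 → 𝒴 → ℝ) (hW0 : ∀ x j y, 0 ≤ W x j y) (hW1 : ∀ x j, ∑ y, W x j y = 1)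
    (PZX : 𝒳 → 𝒵 → ℝ) (hPZX0 : ∀ x z, 0 ≤ PZX x z) (hPZX1 : ∀ x, ∑ z, PZX x z = 1)
    (PUY : 𝒴 → 𝒰 → ℝ) (hPUY0 : ∀ y u, 0 ≤ PUY y u) (hPUY1 : ∀ y, ∑ u, PUY y u = 1) :
    ConcaveOn ℝ
      {Q : 𝒳 → 𝒥 → ℝ | (∀ x j, 0 ≤ Q x j) ∧ ∀ x, ∑ j, Q x j = 1}
      (fun Q =>
        mi2 (fun u y => ∑ x, ∑ j, ∑ z, PX x * Q x j * W x j y * PZX x z * PUY y u)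
          - mi2 (fun u z => ∑ x, ∑ j, ∑ y, PX x * Q x j * W x j y * PZX x z * PUY y u)) := by
  set S : Set (𝒳 → 𝒥 → ℝ) := {Q | (∀ x j, 0 ≤ Q x j) ∧ ∀ x, ∑ j, Q x j = 1}
  have hconv : Convex ℝ S := by
    rintro Q ⟨hQ0, hQ1⟩ Q' ⟨hQ'0, hQ'1⟩ s t hs ht hst
    refine ⟨fun x j => ?_, fun x => ?_⟩
    · exact add_nonneg (mul_nonneg hs (hQ0 x j)) (mul_nonneg ht (hQ'0 x j))
    · simp [sum_add_distrib, ← mul_sum, hQ1, hQ'1, hst]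
  let p : (𝒳 → 𝒥 → ℝ) → 𝒴 → ℝ := fun Q y => ∑ x, ∑ j, PX x * Q x j * W x j y
  let r : (𝒳 → 𝒥 → ℝ) → 𝒰 → 𝒵 → ℝ := fun Q u z =>
    ∑ x, ∑ j, ∑ y, PX x * Q x j * W x j y * PZX x z * PUY y u
  have hp0 : ∀ Q ∈ S, ∀ y, 0 ≤ p Q y := fun Q hQ y =>
    sum_nonneg fun x _ => sum_nonneg fun j _ =>
      mul_nonneg (mul_nonneg (hPX0 x) (hQ.1 x j)) (hW0 x j y)
  have hr0 : ∀ Q ∈ S, ∀ u z, 0 ≤ r Q u z := fun Q hQ u z =>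
    sum_nonneg fun x _ => sum_nonneg fun j _ => sum_nonneg fun y _ =>
      mul_nonneg (mul_nonneg (mul_nonneg (mul_nonneg (hPX0 x) (hQ.1 x j)) (hW0 x j y))
        (hPZX0 x z)) (hPUY0 y u)
  have hUY : ∀ Q u y,
      ∑ x, ∑ j, ∑ z, PX x * Q x j * W x j y * PZX x z * PUY y u = p Q y * PUY y u := by
    intro Q u y
    simp only [p, ← sum_mul, ← mul_sum, hPZX1, mul_one]
  have hU : ∀ Q u, ∑ z, r Q u z = ∑ y, p Q y * PUY y u := by
    intro Q u
    simp only [← hUY, r]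
    calc _ = ∑ x, ∑ j, ∑ z, ∑ y, PX x * Q x j * W x j y * PZX x z * PUY y u := by
          rw [sum_comm]
          exact sum_congr rfl fun x _ => sum_comm
      _ = ∑ x, ∑ j, ∑ y, ∑ z, PX x * Q x j * W x j y * PZX x z * PUY y u :=
          sum_congr rfl fun x _ => sum_congr rfl fun j _ => sum_comm
      _ = _ := by
          rw [sum_comm (s := (univ : Finset 𝒴))]
          exact sum_congr rfl fun x _ => sum_comm
  have hZ : ∀ Q ∈ S, ∀ z, ∑ u, r Q u z = ∑ x, PX x * PZX x z := by
    intro Q hQ z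
    simp only [r]
    rw [sum_comm]
    refine sum_congr rfl fun x _ => ?_
    rw [sum_comm]
    calc _ = ∑ j, PX x * PZX x z * Q x j := by
          refine sum_congr rfl fun j _ => ?_
          rw [sum_comm]
          simp only [← mul_sum, hPUY1, mul_one, ← sum_mul, hW1]
          ring
      _ = _ := by rw [← mul_sum, hQ.2, mul_one]
  have key : Set.EqOn
      (fun Q => (∑ u, ∑ z, Real.negMulLog (r Q u z)
        - ∑ z, Real.negMulLog (∑ x, PX x * PZX x z)
        - ∑ y, p Q y * ∑ u, Real.negMulLog (PUY y u)) / Real.log 2)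
      (fun Q =>
        mi2 (fun u y => ∑ x, ∑ j, ∑ z, PX x * Q x j * W x j y * PZX x z * PUY y u)
          - mi2 (fun u z => ∑ x, ∑ j, ∑ y, PX x * Q x j * W x j y * PZX x z * PUY y u)) S := by
    intro Q hQ
    simp only [hUY]
    rw [mi2_mul_kernel _ _ (hp0 Q hQ) hPUY0 hPUY1, mi2_eq_negMulLog (r Q) (hr0 Q hQ)]
    simp only [hU, hZ Q hQ]
    ring
  refine ConcaveOn.congr ⟨hconv, ?_⟩ key
  intro Q hQ Q' hQ' s t hs ht hst
  have hp : ∀ y, p (s • Q + t • Q') y = s * p Q y + t * p Q' y := by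
    intro y
    simp only [p, mul_sum, ← sum_add_distrib, Pi.add_apply, Pi.smul_apply, smul_eq_mul]
    exact sum_congr rfl fun x _ => sum_congr rfl fun j _ => by ring
  have hr : ∀ u z, r (s • Q + t • Q') u z = s * r Q u z + t * r Q' u z := by
    intro u z
    simp only [r, mul_sum, ← sum_add_distrib, Pi.add_apply, Pi.smul_apply, smul_eq_mul]
    exact sum_congr rfl fun x _ => sum_congr rfl fun j _ => sum_congr rfl fun y _ => by ring
  have hent : s * ∑ u, ∑ z, Real.negMulLog (r Q u z) + t * ∑ u, ∑ z, Real.negMulLog (r Q' u z)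
      ≤ ∑ u, ∑ z, Real.negMulLog (r (s • Q + t • Q') u z) := by
    simp only [mul_sum, ← sum_add_distrib, hr]
    exact sum_le_sum fun u _ => sum_le_sum fun z _ =>
      Real.concaveOn_negMulLog.2 (hr0 Q hQ u z) (hr0 Q' hQ' u z) hs ht hst
  have hlin : ∑ y, p (s • Q + t • Q') y * ∑ u, Real.negMulLog (PUY y u) =
      s * ∑ y, p Q y * ∑ u, Real.negMulLog (PUY y u)
        + t * ∑ y, p Q' y * ∑ u, Real.negMulLog (PUY y u) := by
    rw [mul_sum, mul_sum, ← sum_add_distrib]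
    exact sum_congr rfl fun y _ => by rw [hp]; ring
  simp only [smul_eq_mul, hlin, ← mul_div_assoc, ← add_div]
  refine div_le_div_of_nonneg_right ?_ (Real.log_nonneg one_le_two)
  obtain rfl : t = 1 - s := by linarith
  linarith
end

section
/- Let 𝒳, 𝒥, 𝒴, 𝒵, 𝒰 be finite sets, P_X a pmf on 𝒳, P_{Y|X} a conditional pmf from 𝒳 to 𝒴, W a conditional pmf from 𝒳 × 𝒥 to 𝒵, and P_{U|Y} a conditional pmf from 𝒴 to 𝒰 (this is the case where the adversary controls only the side information Z). For each conditional pmf Q from 𝒳 to 𝒥 define the joint pmf P_Q(x,j,y,z,u) = P_X(x)·Q(j|x)·P_{Y|X}(y|x)·W(z|x,j)·P_{U|Y}(u|y). Then the map Q ↦ I_{P_Q}(U;Y) − I_{P_Q}(U;Z) is concave on the convex set of conditional pmfs from 𝒳 to 𝒥. -/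
open Finset

/-- The tangent-line lower bound for `t ↦ x * log (x / t)`. -/
lemma mul_log_add_sub_le_mul_log_div_s14 {x s c : ℝ} (hx : 0 ≤ x) (hs : 0 ≤ s)
    (hxs : s = 0 → x = 0) (hc : 0 < c) :
    x * Real.log c + x - c * s ≤ x * Real.log (x / s) := by
  rcases hx.eq_or_lt with rfl | hx
  · have := mul_nonneg hc.le hs
    simpa using this
  have hs : 0 < s := lt_of_le_of_ne hs fun h => hx.ne' (hxs h.symm)
  have h := mul_le_mul_of_nonneg_left
    (Real.log_le_sub_one_of_pos (show 0 < c * s / x by positivity)) hx.le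
  rw [Real.log_div (by positivity) hx.ne', Real.log_mul hc.ne' hs.ne'] at h
  have e : x * (c * s / x - 1) = c * s - x := by field_simp
  rw [Real.log_div hx.ne' hs.ne']
  linarith

/-- Joint convexity of `(r, s) ↦ r * log (r / s)`. -/
lemma mul_log_div_convex_s14 {r₁ r₂ s₁ s₂ a b : ℝ} (hr₁ : 0 ≤ r₁) (hr₂ : 0 ≤ r₂)
    (hs₁ : 0 ≤ s₁) (hs₂ : 0 ≤ s₂) (h₁ : s₁ = 0 → r₁ = 0) (h₂ : s₂ = 0 → r₂ = 0)
    (ha : 0 ≤ a) (hb : 0 ≤ b) :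
    (a * r₁ + b * r₂) * Real.log ((a * r₁ + b * r₂) / (a * s₁ + b * s₂)) ≤
      a * (r₁ * Real.log (r₁ / s₁)) + b * (r₂ * Real.log (r₂ / s₂)) := by
  have har := mul_nonneg ha hr₁
  have hbr := mul_nonneg hb hr₂
  have has := mul_nonneg ha hs₁
  have hbs := mul_nonneg hb hs₂
  rcases (add_nonneg har hbr).eq_or_lt with h | h
  · have e₁ : a * r₁ = 0 := by linarith
    have e₂ : b * r₂ = 0 := by linarith
    simp [← mul_assoc, e₁, e₂]
  have hs : 0 < a * s₁ + b * s₂ := by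
    refine (add_nonneg has hbs).lt_of_ne fun h0 => h.ne' ?_
    have e₁ : a * s₁ = 0 := by linarith
    have e₂ : b * s₂ = 0 := by linarith
    have f₁ : a * r₁ = 0 := mul_eq_zero.2 ((mul_eq_zero.1 e₁).imp_right h₁)
    have f₂ : b * r₂ = 0 := mul_eq_zero.2 ((mul_eq_zero.1 e₂).imp_right h₂)
    linarith
  set r := a * r₁ + b * r₂ with hr
  set s := a * s₁ + b * s₂ with hsd
  have hc : 0 < r / s := div_pos h hs
  have t₁ := mul_le_mul_of_nonneg_left (mul_log_add_sub_le_mul_log_div_s14 hr₁ hs₁ h₁ hc) ha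
  have t₂ := mul_le_mul_of_nonneg_left (mul_log_add_sub_le_mul_log_div_s14 hr₂ hs₂ h₂ hc) hb
  have e : r / s * s = r := div_mul_cancel₀ _ hs.ne'
  calc r * Real.log (r / s)
      = a * (r₁ * Real.log (r / s) + r₁ - r / s * s₁)
        + b * (r₂ * Real.log (r / s) + r₂ - r / s * s₂) := by
        linear_combination (Real.log (r / s) + 1) * hr - (r / s) * hsd + e
    _ ≤ _ := add_le_add t₁ t₂

/-- Mutual information is convex along mixtures of joint pmfs with a common first marginal. -/
lemma mi2_convex_of_marginal_eq {𝒜 ℬ : Type*} [Fintype 𝒜] [Fintype ℬ] {R₁ R₂ : 𝒜 → ℬ → ℝ}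
    (h₁ : ∀ u z, 0 ≤ R₁ u z) (h₂ : ∀ u z, 0 ≤ R₂ u z)
    (hm : ∀ u, ∑ z, R₁ u z = ∑ z, R₂ u z) {a b : ℝ} (ha : 0 ≤ a) (hb : 0 ≤ b)
    (hab : a + b = 1) :
    mi2 (fun u z => a * R₁ u z + b * R₂ u z) ≤ a * mi2 R₁ + b * mi2 R₂ := by
  have key : ∀ R : 𝒜 → ℬ → ℝ, (∀ u z, 0 ≤ R u z) → ∀ u z,
      (∑ z', R u z') * (∑ u', R u' z) = 0 → R u z = 0 := by
    intro R hR u z h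
    rcases mul_eq_zero.1 h with h | h
    · exact (sum_eq_zero_iff_of_nonneg fun i _ => hR u i).1 h z (mem_univ _)
    · exact (sum_eq_zero_iff_of_nonneg fun i _ => hR i z).1 h u (mem_univ _)
  have nonneg : ∀ R : 𝒜 → ℬ → ℝ, (∀ u z, 0 ≤ R u z) → ∀ u z,
      0 ≤ (∑ z', R u z') * (∑ u', R u' z) := fun R hR u z =>
    mul_nonneg (sum_nonneg fun i _ => hR u i) (sum_nonneg fun i _ => hR i z)
  unfold mi2
  simp only [mul_sum, ← sum_add_distrib]
  refine sum_le_sum fun u _ => sum_le_sum fun z _ => ?_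
  simp only [← mul_sum]
  have e : (∑ z', (a * R₁ u z' + b * R₂ u z')) * (∑ u', (a * R₁ u' z + b * R₂ u' z))
      = a * ((∑ z', R₁ u z') * (∑ u', R₁ u' z)) + b * ((∑ z', R₂ u z') * (∑ u', R₂ u' z)) := by
    simp only [sum_add_distrib, ← mul_sum]
    rw [hm u]
    linear_combination (∑ z', R₂ u z') * (a * (∑ u', R₁ u' z) + b * (∑ u', R₂ u' z)) * hab
  rw [e]
  have h := mul_log_div_convex_s14 (h₁ u z) (h₂ u z) (nonneg R₁ h₁ u z) (nonneg R₂ h₂ u z)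
    (key R₁ h₁ u z) (key R₂ h₂ u z) ha hb
  have h := div_le_div_of_nonneg_right h (Real.log_pos one_lt_two).le
  simp only [Real.logb]
  convert h using 1 <;> ring

/-- Adversary controlling only the side information `Z`: with
`P_Q(x,j,y,z,u) = P_X(x)·Q(j|x)·P_{Y|X}(y|x)·W(z|x,j)·P_{U|Y}(u|y)`, the map
`Q ↦ I_{P_Q}(U;Y) − I_{P_Q}(U;Z)` is concave on the convex set of conditional pmfs
from `𝒳` to `𝒥`. -/
theorem stmt14 {𝒳 𝒥 𝒴 𝒵 𝒰 : Type*}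
    [Fintype 𝒳] [Fintype 𝒥] [Fintype 𝒴] [Fintype 𝒵] [Fintype 𝒰]
    (PX : 𝒳 → ℝ) (hPX0 : ∀ x, 0 ≤ PX x) (hPX1 : ∑ x, PX x = 1)
    (PYX : 𝒳 → 𝒴 → ℝ) (hPYX0 : ∀ x y, 0 ≤ PYX x y) (hPYX1 : ∀ x, ∑ y, PYX x y = 1)
    (W : 𝒳 → 𝒥 → 𝒵 → ℝ) (hW0 : ∀ x j z, 0 ≤ W x j z) (hW1 : ∀ x j, ∑ z, W x j z = 1)
    (PUY : 𝒴 → 𝒰 → ℝ) (hPUY0 : ∀ y u, 0 ≤ PUY y u) (hPUY1 : ∀ y, ∑ u, PUY y u = 1) :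
    ConcaveOn ℝ
      {Q : 𝒳 → 𝒥 → ℝ | (∀ x j, 0 ≤ Q x j) ∧ ∀ x, ∑ j, Q x j = 1}
      (fun Q =>
        mi2 (fun u y => ∑ x, ∑ j, ∑ z, PX x * Q x j * PYX x y * W x j z * PUY y u)
          - mi2 (fun u z => ∑ x, ∑ j, ∑ y, PX x * Q x j * PYX x y * W x j z * PUY y u)) := by
  set S := {Q : 𝒳 → 𝒥 → ℝ | (∀ x j, 0 ≤ Q x j) ∧ ∀ x, ∑ j, Q x j = 1} with hS
  have hconv : Convex ℝ S := by
    rintro Q ⟨hQ0, hQ1⟩ Q' ⟨hQ'0, hQ'1⟩ a b ha hb hab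
    refine ⟨fun x j => ?_, fun x => ?_⟩
    · exact add_nonneg (mul_nonneg ha (hQ0 x j)) (mul_nonneg hb (hQ'0 x j))
    · simp [sum_add_distrib, ← mul_sum, hQ1, hQ'1, hab]
  have hUY : ∀ Q ∈ S, (fun u y => ∑ x, ∑ j, ∑ z, PX x * Q x j * PYX x y * W x j z * PUY y u)
      = fun u y => ∑ x, PX x * PYX x y * PUY y u := by
    rintro Q ⟨-, hQ1⟩
    funext u y
    refine sum_congr rfl fun x _ => ?_
    calc _ = ∑ j, Q x j * (PX x * PYX x y * PUY y u) := by
          refine sum_congr rfl fun j _ => ?_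
          rw [← sum_mul, ← mul_sum, hW1]
          ring
      _ = _ := by rw [← sum_mul, hQ1, one_mul]
  have hU : ∀ Q ∈ S, ∀ u, ∑ z, ∑ x, ∑ j, ∑ y, PX x * Q x j * PYX x y * W x j z * PUY y u
      = ∑ y, ∑ x, PX x * PYX x y * PUY y u := by
    intro Q hQ u
    rw [← sum_congr rfl fun y _ => congrFun (congrFun (hUY Q hQ) u) y]
    rw [sum_comm, sum_comm (s := (univ : Finset 𝒴))]
    refine sum_congr rfl fun x _ => ?_
    rw [sum_comm, sum_comm (s := (univ : Finset 𝒴))]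
    exact sum_congr rfl fun j _ => sum_comm
  have hnonneg : ∀ Q ∈ S, ∀ u z,
      0 ≤ ∑ x, ∑ j, ∑ y, PX x * Q x j * PYX x y * W x j z * PUY y u := by
    rintro Q ⟨hQ0, -⟩ u z
    refine sum_nonneg fun x _ => sum_nonneg fun j _ => sum_nonneg fun y _ => ?_
    exact mul_nonneg (mul_nonneg (mul_nonneg (mul_nonneg (hPX0 x) (hQ0 x j)) (hPYX0 x y))
      (hW0 x j z)) (hPUY0 y u)
  refine ⟨hconv, fun Q hQ Q' hQ' a b ha hb hab => ?_⟩
  have hlin : (fun u z => ∑ x, ∑ j, ∑ y,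
        PX x * (a • Q + b • Q') x j * PYX x y * W x j z * PUY y u)
      = fun u z => a * (∑ x, ∑ j, ∑ y, PX x * Q x j * PYX x y * W x j z * PUY y u)
        + b * (∑ x, ∑ j, ∑ y, PX x * Q' x j * PYX x y * W x j z * PUY y u) := by
    funext u z
    simp only [mul_sum, ← sum_add_distrib, Pi.add_apply, Pi.smul_apply, smul_eq_mul]
    refine sum_congr rfl fun x _ => sum_congr rfl fun j _ => sum_congr rfl fun y _ => ?_
    ring
  have hle := mi2_convex_of_marginal_eq (hnonneg Q hQ) (hnonneg Q' hQ')
    (fun u => (hU Q hQ u).trans (hU Q' hQ' u).symm) ha hb hab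
  beta_reduce
  rw [hUY Q hQ, hUY Q' hQ', hUY _ (hconv hQ hQ' ha hb hab), hlin, smul_eq_mul, smul_eq_mul]
  set C := mi2 fun u y => ∑ x, PX x * PYX x y * PUY y u
  linear_combination hle + C * hab
end
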